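/- Let n ≥ 2 and let G be a proper transitive subgroup of S_n. Then for every ε > 0 there is a constant c(n,ε) such that for all X ≥ 2, F_n(X;G) ≤ c(n,ε) · X^{δ_n+ε}, where δ_n = (n+2)/4 − 1/(2n−2). -/

import Mathlib

open Polynomial

noncomputable section

/-- A fixed algebraic closure of `ℚ`. -/
abbrev Qbar : Type := AlgebraicClosure ℚ

/-- The discriminant of a subfield of `ℚ̄` (zero if it is not a number field). -/
def fieldDiscr (K : IntermediateField ℚ Qbar) : ℤ := by
  by_cases h : FiniteDimensional ℚ K
  · exact @NumberField.discr K _ ⟨⟩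
  · exact 0

/-- The action of `Gal(ℚ̄/ℚ)` on the embeddings of `K` into `ℚ̄`; its image is the
Galois group of the Galois closure of `K`, acting on the embeddings of `K`. -/
def galAct (K : IntermediateField ℚ Qbar) :
    (Qbar ≃ₐ[ℚ] Qbar) →* Equiv.Perm (K →ₐ[ℚ] Qbar) where
  toFun σ :=
    { toFun := fun ι => σ.toAlgHom.comp ι
      invFun := fun ι => σ.symm.toAlgHom.comp ι
      left_inv := fun ι => by ext x; simp
      right_inv := fun ι => by ext x; simp }
  map_one' := by
    apply Equiv.ext; intro ι; ext x; simp
  map_mul' := fun σ τ => by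
    apply Equiv.ext; intro ι; ext x; simp

/-- `K` has Galois group (of its Galois closure, acting on the `n` embeddings of `K` in `ℚ̄`)
equal to `G`, up to conjugacy; this is encoded by an identification of the embeddings
with `Fin n` under which the image of the Galois action is exactly `G`. -/
def HasGalGroup (n : ℕ) (K : IntermediateField ℚ Qbar)
    (G : Subgroup (Equiv.Perm (Fin n))) : Prop :=
  ∃ e : (K →ₐ[ℚ] Qbar) ≃ Fin n, ∀ σ : Equiv.Perm (Fin n),
    σ ∈ G ↔ ∃ g : Qbar ≃ₐ[ℚ] Qbar, Equiv.permCongr e (galAct K g) = σ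

/-- The number of number fields of degree `n`, absolute discriminant at most `X`,
and Galois group (as a permutation group on the embeddings) conjugate to `G`. -/
def FnG (n : ℕ) (X : ℝ) (G : Subgroup (Equiv.Perm (Fin n))) : ℕ :=
  Nat.card {K : IntermediateField ℚ Qbar //
    Module.finrank ℚ K = n ∧ |(fieldDiscr K : ℝ)| ≤ X ∧ HasGalGroup n K G}

/-- The number of number fields of degree `n` and absolute discriminant at most `X`. -/
def FnAll (n : ℕ) (X : ℝ) : ℕ :=
  Nat.card {K : IntermediateField ℚ Qbar //
    Module.finrank ℚ K = n ∧ |(fieldDiscr K : ℝ)| ≤ X}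

/-- A subgroup of the permutations of `β` is transitive. -/
def IsTransitiveSub {β : Type*} (G : Subgroup (Equiv.Perm β)) : Prop :=
  ∀ x y : β, ∃ σ ∈ G, σ x = y

/-- `G` admits a nontrivial block system: a partition of `β` into `k ≥ 2` nonempty parts,
some part having at least two elements, whose parts are permuted by every element of `G`. -/
def HasBlockSystem {β : Type*} (G : Subgroup (Equiv.Perm β)) : Prop :=
  ∃ (k : ℕ) (R : Fin k → Set β), 2 ≤ k ∧
    (∀ j, (R j).Nonempty) ∧
    (∃ j, 2 ≤ Nat.card (R j)) ∧
    (∀ x : β, ∃! j, x ∈ R j) ∧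
    (∀ σ ∈ G, ∀ i, ∃ j, (fun x => σ x) '' R i = R j)

/-- An imprimitive permutation group: transitive with a nontrivial block system. -/
def IsImprimitiveSub {β : Type*} (G : Subgroup (Equiv.Perm β)) : Prop :=
  IsTransitiveSub G ∧ HasBlockSystem G

/-- A primitive permutation group: transitive with no nontrivial block system. -/
def IsPrimitiveSub {β : Type*} (G : Subgroup (Equiv.Perm β)) : Prop :=
  IsTransitiveSub G ∧ ¬ HasBlockSystem G

end

open NumberField NumberField.ComplexEmbedding MeasureTheory

/-- The sum of the real and the imaginary part of a complex number. -/
noncomputable def reIm (z : ℂ) : ℝ := z.re + z.im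

theorem norm_le_two_mul_of_reIm {z : ℂ} {A : ℝ} (h : |reIm z| ≤ A)
    (h' : |reIm (starRingEnd ℂ z)| ≤ A) : ‖z‖ ≤ 2 * A := by
  have h1 := Complex.norm_le_abs_re_add_abs_im z
  simp only [reIm, Complex.conj_re, Complex.conj_im] at h h'
  rw [abs_le] at h h'
  have h2 : |z.re| ≤ A := by rw [abs_le]; constructor <;> linarith
  have h3 : |z.im| ≤ A := by rw [abs_le]; constructor <;> linarith
  linarith

theorem norm_lt_one_of_reIm {z : ℂ} (h : |reIm z| < 1 / 2)
    (h' : |reIm (starRingEnd ℂ z)| < 1 / 2) : ‖z‖ < 1 := by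
  have h1 := Complex.norm_le_abs_re_add_abs_im z
  simp only [reIm, Complex.conj_re, Complex.conj_im] at h h'
  rw [abs_lt] at h h'
  have h2 : |z.re| < 1 / 2 := by rw [abs_lt]; constructor <;> linarith
  have h3 : |z.im| < 1 / 2 := by rw [abs_lt]; constructor <;> linarith
  linarith

theorem abs_reIm_le (z : ℂ) : |reIm z| ≤ 2 * ‖z‖ := by
  have h1 := Complex.abs_re_le_norm z
  have h2 := Complex.abs_im_le_norm z
  have := abs_add_le z.re z.im
  unfold reIm
  linarith

theorem norm_det_conj_mix {ι : Type*} [Fintype ι] [DecidableEq ι] (c : Equiv.Perm ι)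
    (hc : c * c = 1) :
    ‖(((1 - Complex.I) / 2) • (1 : Matrix ι ι ℂ) +
      ((1 + Complex.I) / 2) • c.permMatrix ℂ).det‖ = 1 := by
  set P := ((1 - Complex.I) / 2) • (1 : Matrix ι ι ℂ) +
      ((1 + Complex.I) / 2) • c.permMatrix ℂ with hP
  have hQ : c.permMatrix ℂ * c.permMatrix ℂ = 1 := by
    rw [← Matrix.permMatrix_mul, hc, Matrix.permMatrix_one]
  have hQ' : (c.permMatrix ℂ).conjTranspose = c.permMatrix ℂ := by
    rw [Matrix.conjTranspose_permMatrix, inv_eq_of_mul_eq_one_left hc]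
  have h1 : star ((1 - Complex.I) / 2) = (1 + Complex.I) / 2 := by
    simp [sub_eq_add_neg]
  have h2 : star ((1 + Complex.I) / 2) = (1 - Complex.I) / 2 := by
    simp [sub_eq_add_neg]
  have hPP : P * P.conjTranspose = 1 := by
    rw [hP, Matrix.conjTranspose_add, Matrix.conjTranspose_smul, Matrix.conjTranspose_smul, hQ',
      h1, h2, Matrix.conjTranspose_one]
    simp only [add_mul, mul_add, smul_mul_assoc, mul_smul_comm, one_mul, mul_one, hQ]
    simp only [smul_add, smul_smul]
    have e1 : (1 - Complex.I) / 2 * ((1 + Complex.I) / 2) = 1 / 2 := by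
      ring_nf; simp; norm_num
    have e2 : (1 + Complex.I) / 2 * ((1 - Complex.I) / 2) = 1 / 2 := by
      ring_nf; simp; norm_num
    have e3 : (1 - Complex.I) / 2 * ((1 - Complex.I) / 2) =
        - ((1 + Complex.I) / 2 * ((1 + Complex.I) / 2)) := by
      ring_nf; simp
    rw [e1, e2, e3, neg_smul]
    have : (1 / 2 : ℂ) • (1 : Matrix ι ι ℂ) + (1 / 2 : ℂ) • (1 : Matrix ι ι ℂ) = 1 := by
      rw [← add_smul]; norm_num
    refine Eq.trans ?_ this
    abel
  have := congrArg Matrix.det hPP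
  rw [Matrix.det_mul, Matrix.det_conjTranspose, Matrix.det_one] at this
  have h2 := congrArg norm this
  rw [norm_mul, norm_star, norm_one] at h2
  nlinarith [norm_nonneg P.det]

section
variable (K : Type*) [Field K] [NumberField K]

/-- An integral basis indexed by complex embeddings. -/
noncomputable def embBasis : Module.Basis (K →+* ℂ) ℚ K :=
  (integralBasis K).reindex (Fintype.equivOfCardEq (by
    rw [← Module.finrank_eq_card_basis (integralBasis K), Embeddings.card K ℂ]))

theorem isIntegral_embBasis (i) : IsIntegral ℤ (embBasis K i) := by
  rw [embBasis, Module.Basis.reindex_apply, integralBasis_apply]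
  exact RingOfIntegers.isIntegral_coe _

open Classical in
theorem det_embBasis_sq :
    (Matrix.of fun i (φ : K →+* ℂ) => φ (embBasis K i)).det ^ 2 = ((discr K : ℤ) : ℂ) := by
  have h := Algebra.discr_eq_det_embeddingsMatrixReindex_pow_two ℚ ℂ (embBasis K)
    (RingHom.equivRatAlgHom (R := K) (S := ℂ))
  have h' : Algebra.embeddingsMatrixReindex ℚ ℂ (embBasis K)
    (RingHom.equivRatAlgHom (R := K) (S := ℂ)) =
      Matrix.of fun i (φ : K →+* ℂ) => φ (embBasis K i) := by ext; rfl
  rw [h', embBasis, Module.Basis.coe_reindex, Algebra.discr_reindex, ← coe_discr] at h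
  rw [show ((discr K : ℤ) : ℂ) = algebraMap ℚ ℂ ((discr K : ℤ) : ℚ) by simp, h, embBasis,
    Module.Basis.coe_reindex]

/-- The vectors spanning the lattice of integers of `K`. -/
noncomputable def embVec (i : K →+* ℂ) : (K →+* ℂ) → ℝ := fun φ => reIm (φ (embBasis K i))

open Classical in
theorem abs_det_embVec : |(Matrix.of (embVec K)).det| = √|(discr K : ℝ)| := by
  let c : Equiv.Perm (K →+* ℂ) := ⟨conjugate, conjugate, involutive_conjugate K,
    involutive_conjugate K⟩
  have hc : c * c = 1 := Equiv.ext fun x => involutive_conjugate K x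
  set Φ := Matrix.of fun i (φ : K →+* ℂ) => φ (embBasis K i) with hΦ
  have h : (Matrix.of (embVec K)).map (algebraMap ℝ ℂ) = Φ * (((1 - Complex.I) / 2) •
      (1 : Matrix (K →+* ℂ) (K →+* ℂ) ℂ) + ((1 + Complex.I) / 2) • c.permMatrix ℂ) := by
    ext i φ
    rw [mul_add, mul_smul_comm, mul_smul_comm, mul_one, Equiv.Perm.permMatrix,
      PEquiv.mul_toMatrix_toPEquiv]
    have : c.symm φ = conjugate φ := rfl
    simp only [Matrix.map_apply, Matrix.of_apply, Matrix.add_apply, Matrix.smul_apply, hΦ,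
      Matrix.submatrix_apply, this, conjugate_coe_eq, embVec, reIm, id]
    apply Complex.ext <;> simp <;> ring
  have h2 := congrArg Matrix.det h
  rw [Matrix.det_mul] at h2
  have h3 : (Matrix.det ((Matrix.of (embVec K)).map (algebraMap ℝ ℂ))) =
    algebraMap ℝ ℂ (Matrix.of (embVec K)).det := (RingHom.map_det _ _).symm
  rw [h3] at h2
  have h4 := congrArg norm h2
  rw [norm_mul, norm_det_conj_mix c hc, mul_one] at h4
  have h5 : |(Matrix.of (embVec K)).det| = ‖Φ.det‖ := by simpa using h4
  have h6 := congrArg norm (det_embBasis_sq K)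
  rw [norm_pow, Complex.norm_intCast] at h6
  rw [h5, ← h6, Real.sqrt_sq (norm_nonneg _)]

open Classical in
theorem exists_integer_of_volume (s : Set ((K →+* ℂ) → ℝ)) (hs : MeasurableSet s)
    (h : ENNReal.ofReal √|(discr K : ℝ)| < volume s) :
    ∃ β : K, β ≠ 0 ∧ IsIntegral ℤ β ∧ ∃ x ∈ s, ∃ y ∈ s, ∀ φ : K →+* ℂ, reIm (φ β) = x φ - y φ := by
  have hdet : (Matrix.of (embVec K)).det ≠ 0 := by
    rw [← abs_pos, abs_det_embVec, Real.sqrt_pos, abs_pos]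
    exact_mod_cast discr_ne_zero K
  have hli : LinearIndependent ℝ (embVec K) := by
    have := Matrix.linearIndependent_rows_iff_isUnit.2
      ((Matrix.isUnit_iff_isUnit_det _).2 (isUnit_iff_ne_zero.2 hdet))
    exact this
  let b : Module.Basis (K →+* ℂ) ℝ ((K →+* ℂ) → ℝ) := basisOfPiSpaceOfLinearIndependent hli
  have hb : ⇑b = embVec K := coe_basisOfPiSpaceOfLinearIndependent hli
  have hvol : volume (ZSpan.fundamentalDomain b) < volume s := by
    rw [ZSpan.volume_fundamentalDomain, hb, abs_det_embVec]
    exact h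
  have : Countable (Submodule.span ℤ (Set.range b)).toAddSubgroup :=
    inferInstanceAs (Countable (Submodule.span ℤ (Set.range b)))
  have := exists_pair_mem_lattice_not_disjoint_vadd
    (L := (Submodule.span ℤ (Set.range b)).toAddSubgroup)
    (ZSpan.isAddFundamentalDomain' b volume) hs.nullMeasurableSet hvol
  obtain ⟨u, v, huv, hd⟩ := this
  obtain ⟨_, ⟨y, hy, rfl⟩, x, hx, hxy⟩ := Set.not_disjoint_iff.mp hd
  have hmem : ((u - v : (Submodule.span ℤ (Set.range b)).toAddSubgroup) : (K →+* ℂ) → ℝ) ∈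
    Submodule.span ℤ (Set.range b) := (u - v).2
  have hsub : ((u - v : (Submodule.span ℤ (Set.range b)).toAddSubgroup) : (K →+* ℂ) → ℝ) =
      x - y := by
    simp only [AddSubgroup.vadd_def, vadd_eq_add] at hxy
    rw [AddSubgroup.coe_sub, sub_eq_sub_iff_add_eq_add, ← hxy, add_comm]
  obtain ⟨k, hk⟩ := (Submodule.mem_span_range_iff_exists_fun ℤ).1 hmem
  refine ⟨∑ i, k i • embBasis K i, ?_, ?_, x, hx, y, hy, ?_⟩
  · intro h0
    have hk0 : ∀ i, (k i : ℚ) = 0 := by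
      refine Fintype.linearIndependent_iff.1 (embBasis K).linearIndependent (fun i => (k i : ℚ)) ?_
      simpa [Int.cast_smul_eq_zsmul] using h0
    have hk0' : ∀ i, k i = 0 := fun i => by exact_mod_cast hk0 i
    apply huv
    rw [← sub_eq_zero]
    apply Subtype.ext
    rw [← hk]
    simp [hk0']
  · exact IsIntegral.sum _ fun i _ => (isIntegral_embBasis K i).smul _
  · intro φ
    have := congrFun (hk.trans hsub) φ
    rw [Pi.sub_apply, Finset.sum_apply] at this
    rw [← this, hb, map_sum]
    simp only [reIm, Complex.re_sum, Complex.im_sum, ← Finset.sum_add_distrib, embVec,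
      Pi.smul_apply]
    refine Finset.sum_congr rfl fun i _ => ?_
    rw [map_zsmul]
    simp
end

theorem eq_zero_of_norm_lt_one {F : Type*} [Field F] [NumberField F] {x : F} (hx : IsIntegral ℤ x)
    (h : ∀ τ : F →+* ℂ, ‖τ x‖ < 1) : x = 0 := by
  by_contra h0
  obtain ⟨n, hn, hx1⟩ := Embeddings.pow_eq_one_of_norm_le_one F ℂ h0 hx (fun τ => (h τ).le)
  obtain ⟨τ⟩ : Nonempty (F →+* ℂ) := inferInstance
  have h1 : ‖τ x‖ ^ n = 1 := by rw [← norm_pow, ← map_pow, hx1, map_one, norm_one]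
  have h2 := pow_lt_one₀ (norm_nonneg _) (h τ) hn.ne'
  linarith

theorem eq_zero_of_reIm_lt {F : Type*} [Field F] [NumberField F] {x : F} (hx : IsIntegral ℤ x)
    (h : ∀ τ : F →+* ℂ, |reIm (τ x)| < 1 / 2) : x = 0 :=
  eq_zero_of_norm_lt_one hx fun τ => norm_lt_one_of_reIm (h τ) (h (conjugate τ))

open Classical in
theorem map_trace_eq_sum {F K : Type*} [Field F] [Field K] [NumberField F] [NumberField K]
    [Algebra F K] (τ : F →+* ℂ) (x : K) :
    τ (Algebra.trace F K x) =
      ∑ φ ∈ Finset.univ.filter (fun φ : K →+* ℂ => φ.comp (algebraMap F K) = τ), φ x := by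
  let := τ.toAlgebra
  have h := trace_eq_sum_embeddings (K := F) (L := K) ℂ (x := x)
  rw [RingHom.algebraMap_toAlgebra] at h
  rw [h]
  refine Finset.sum_bij (fun σ _ => (σ : K →+* ℂ)) ?_ ?_ ?_ ?_
  · intro σ _
    simp only [Finset.mem_filter, Finset.mem_univ, true_and]
    exact σ.comp_algebraMap
  · intro a _ b _ hab
    exact AlgHom.coe_ringHom_injective hab
  · intro φ hφ
    simp only [Finset.mem_filter, Finset.mem_univ, true_and] at hφ
    exact ⟨{ φ with commutes' := fun r => RingHom.congr_fun hφ r }, Finset.mem_univ _, rfl⟩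
  · intro _ _; rfl

theorem reIm_sum {ι : Type*} (s : Finset ι) (f : ι → ℂ) :
    reIm (∑ i ∈ s, f i) = ∑ i ∈ s, reIm (f i) := by
  simp [reIm, Finset.sum_add_distrib]

open Classical in
theorem exists_small_trace_zero (F K : Type*) [Field F] [Field K] [NumberField F] [NumberField K]
    [Algebra F K] (A : ℝ) (hA : 1 ≤ A)
    (h : √|(discr K : ℝ)| * (3 * Module.finrank ℚ K * A) ^ Module.finrank ℚ F <
      A ^ Module.finrank ℚ K) :
    ∃ β : K, β ≠ 0 ∧ IsIntegral ℤ β ∧ Algebra.trace F K β = 0 ∧ ∀ φ : K →+* ℂ, ‖φ β‖ ≤ 2 * A := by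
  set n := Module.finrank ℚ K with hn
  have hn1 : 1 ≤ n := Module.finrank_pos
  let fib : (F →+* ℂ) → Finset (K →+* ℂ) := fun τ =>
    Finset.univ.filter (fun φ : K →+* ℂ => φ.comp (algebraMap F K) = τ)
  let T : ((K →+* ℂ) → ℝ) → (F →+* ℂ) → ℝ := fun x τ => ∑ φ ∈ fib τ, x φ
  let g : ((K →+* ℂ) → ℝ) → (F →+* ℂ) → ℤ := fun x τ => ⌊2 * T x τ⌋
  let U : Set ((K →+* ℂ) → ℝ) := Set.univ.pi fun _ => Set.Ico 0 A
  let N : ℤ := ⌊2 * (n : ℝ) * A⌋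
  have hN0 : 0 ≤ N := Int.floor_nonneg.2 (by positivity)
  let I : Finset ((F →+* ℂ) → ℤ) := Fintype.piFinset fun _ => Finset.Icc 0 N
  have hgm : Measurable g := by
    refine measurable_pi_lambda _ fun τ => ?_
    refine Int.measurable_floor.comp ?_
    exact (Finset.measurable_sum _ fun φ _ => measurable_pi_apply φ).const_mul 2
  have hUm : MeasurableSet U := MeasurableSet.univ_pi fun _ => measurableSet_Ico
  have hgI : ∀ x ∈ U, g x ∈ I := by
    intro x hx
    rw [Fintype.mem_piFinset]
    intro τ
    have h0 : 0 ≤ T x τ := Finset.sum_nonneg fun φ _ => (hx φ trivial).1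
    have h1 : T x τ ≤ n * A := by
      calc T x τ ≤ ∑ φ ∈ fib τ, A := Finset.sum_le_sum fun φ _ => (hx φ trivial).2.le
        _ = (fib τ).card * A := by simp
        _ ≤ n * A := by
          gcongr
          rw [hn, ← Embeddings.card K ℂ]
          exact Finset.card_le_univ _
    rw [Finset.mem_Icc]
    exact ⟨Int.floor_nonneg.2 (by positivity), Int.floor_le_floor (by linarith)⟩
  have hcov : U ⊆ ⋃ k ∈ I, U ∩ g ⁻¹' {k} := by
    intro x hx
    simp only [Set.mem_iUnion]
    exact ⟨g x, hgI x hx, hx, rfl⟩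
  have hvolU : volume U = ENNReal.ofReal (A ^ n) := by
    rw [volume_pi_pi]
    simp only [Real.volume_Ico, sub_zero, Finset.prod_const, Finset.card_univ]
    rw [Embeddings.card K ℂ, ENNReal.ofReal_pow (by linarith)]
  obtain ⟨k, -, hk⟩ : ∃ k ∈ I, ENNReal.ofReal √|(discr K : ℝ)| < volume (U ∩ g ⁻¹' {k}) := by
    by_contra! hcon
    have h1 : volume U ≤ ∑ k ∈ I, volume (U ∩ g ⁻¹' {k}) :=
      (measure_mono hcov).trans (measure_biUnion_finset_le _ _)
    have h2 := h1.trans (Finset.sum_le_sum hcon)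
    have hIc : (I.card : ℝ) ≤ (3 * n * A) ^ Module.finrank ℚ F := by
      rw [Fintype.card_piFinset]
      simp only [Int.card_Icc, sub_zero, Finset.prod_const, Finset.card_univ]
      rw [Embeddings.card F ℂ]
      push_cast
      gcongr
      have e1 : (((N + 1).toNat : ℕ) : ℝ) = (N : ℝ) + 1 := by
        have : (((N + 1).toNat : ℕ) : ℤ) = N + 1 := Int.toNat_of_nonneg (by omega)
        exact_mod_cast this
      rw [e1]
      have e2 : (N : ℝ) ≤ 2 * n * A := Int.floor_le _
      have e3 : (1 : ℝ) ≤ n * A := by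
        have : (1 : ℝ) ≤ n := by exact_mod_cast hn1
        nlinarith
      linarith
    rw [hvolU, Finset.sum_const, nsmul_eq_mul, ← ENNReal.ofReal_natCast, ← ENNReal.ofReal_mul
      (by positivity), ENNReal.ofReal_le_ofReal_iff (by positivity)] at h2
    have h3 := mul_le_mul_of_nonneg_right hIc (Real.sqrt_nonneg |(discr K : ℝ)|)
    linarith
  obtain ⟨β, hβ0, hβi, x, hx, y, hy, hxy⟩ := exists_integer_of_volume K _
    (hUm.inter (hgm (measurableSet_singleton k))) hk
  refine ⟨β, hβ0, hβi, ?_, ?_⟩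
  · refine eq_zero_of_reIm_lt (Algebra.isIntegral_trace hβi) fun τ => ?_
    rw [map_trace_eq_sum, reIm_sum]
    have e1 : ∑ φ ∈ fib τ, reIm (φ β) = T x τ - T y τ := by
      rw [← Finset.sum_sub_distrib]
      exact Finset.sum_congr rfl fun φ _ => hxy φ
    have e2 : ⌊2 * T x τ⌋ = ⌊2 * T y τ⌋ := congrFun (hx.2.trans hy.2.symm) τ
    have e3 := Int.abs_sub_lt_one_of_floor_eq_floor e2
    have e4 : |2 * T x τ - 2 * T y τ| = 2 * |T x τ - T y τ| := by
      rw [← mul_sub, abs_mul]; simp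
    change |∑ φ ∈ fib τ, reIm (φ β)| < _
    rw [e1]
    linarith
  · have hb : ∀ φ : K →+* ℂ, |reIm (φ β)| ≤ A := by
      intro φ
      have h1 := hx.1 φ trivial
      have h2 := hy.1 φ trivial
      rw [hxy, abs_le]
      constructor <;> linarith [h1.1, h1.2, h2.1, h2.2]
    exact fun φ => norm_le_two_mul_of_reIm (hb φ) (hb (conjugate φ))

instance isAlgebraic_Qbar : Algebra.IsAlgebraic ℚ Qbar := by
  have h : Algebra.IsAlgebraic ℚ (AlgebraicClosure ℚ) := AlgebraicClosure.isAlgebraic ℚ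
  exact h

theorem ncard_integers_le (F : Type*) [Field F] [NumberField F] {B : ℝ} (hB : 1 ≤ B) :
    {a : F | IsIntegral ℤ a ∧ ∀ τ : F →+* ℂ, ‖τ a‖ ≤ B}.Finite ∧
    ({a : F | IsIntegral ℤ a ∧ ∀ τ : F →+* ℂ, ‖τ a‖ ≤ B}.ncard : ℝ) ≤
      (10 * B) ^ Module.finrank ℚ F := by
  classical
  refine ⟨Embeddings.finite_of_norm_le F ℂ B, ?_⟩
  set S := {a : F | IsIntegral ℤ a ∧ ∀ τ : F →+* ℂ, ‖τ a‖ ≤ B} with hS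
  let M : ℤ := ⌊4 * B⌋
  let m : ℤ := ⌊-(4 * B)⌋
  let I : Finset ((F →+* ℂ) → ℤ) := Fintype.piFinset fun _ => Finset.Icc m M
  have h1 : S.ncard ≤ (I : Set ((F →+* ℂ) → ℤ)).ncard := by
    refine Set.ncard_le_ncard_of_injOn (fun a τ => ⌊2 * reIm (τ a)⌋) ?_ ?_ I.finite_toSet
    · intro a ha
      rw [Finset.mem_coe, Fintype.mem_piFinset]
      intro τ
      have h2 := (abs_reIm_le (τ a)).trans (mul_le_mul_of_nonneg_left (ha.2 τ) zero_le_two)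
      rw [abs_le] at h2
      rw [Finset.mem_Icc]
      exact ⟨Int.floor_le_floor (by linarith), Int.floor_le_floor (by linarith)⟩
    · intro a ha b hb hab
      rw [← sub_eq_zero]
      refine eq_zero_of_reIm_lt (ha.1.sub hb.1) fun τ => ?_
      have e3 := Int.abs_sub_lt_one_of_floor_eq_floor (congrFun hab τ)
      have e4 : |2 * reIm (τ a) - 2 * reIm (τ b)| = 2 * |reIm (τ (a - b))| := by
        rw [← mul_sub, abs_mul, map_sub]; simp [reIm]; ring_nf
      linarith
  rw [Set.ncard_coe_finset, Fintype.card_piFinset] at h1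
  simp only [Int.card_Icc, Finset.prod_const, Finset.card_univ] at h1
  rw [Embeddings.card F ℂ] at h1
  refine (Nat.cast_le.2 h1).trans ?_
  push_cast
  gcongr
  have hM : (M : ℝ) ≤ 4 * B := Int.floor_le _
  have hm : -(4 * B) < (m : ℝ) + 1 := Int.lt_floor_add_one _
  have hmM : m ≤ M := Int.floor_le_floor (by linarith)
  have e1 : (((M + 1 - m).toNat : ℕ) : ℝ) = (M : ℝ) + 1 - m := by
    have : (((M + 1 - m).toNat : ℕ) : ℤ) = M + 1 - m := Int.toNat_of_nonneg (by omega)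
    exact_mod_cast this
  rw [e1]
  linarith

section
variable (F : Type*) [Field F] [NumberField F] [Algebra F Qbar]

/-- Monic polynomials of degree `m` over `F` with vanishing next coefficient, and integral
coefficients bounded as elementary symmetric functions of numbers of size `B`. -/
def polySet (m : ℕ) (B : ℝ) : Set F[X] :=
  {f | f.Monic ∧ f.natDegree = m ∧ f.nextCoeff = 0 ∧ ∀ i < m, IsIntegral ℤ (f.coeff i) ∧
    ∀ τ : F →+* ℂ, ‖τ (f.coeff i)‖ ≤ B ^ (m - i)}

/-- Integral elements of relative degree `m` over `F`, of relative trace zero, all of whose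
conjugates have size at most `B`. -/
def elemSet (m : ℕ) (B : ℝ) : Set Qbar :=
  {β | IsIntegral ℤ β ∧ (minpoly F β).natDegree = m ∧ (minpoly F β).nextCoeff = 0 ∧
    ∀ φ : Qbar →+* ℂ, ‖φ β‖ ≤ B}

omit [Algebra F Qbar] in
theorem polySet_ncard_le {m : ℕ} {B : ℝ} (hB : 1 ≤ B) : (polySet F m B).Finite ∧
    ((polySet F m B).ncard : ℝ) ≤
      ∏ i ∈ Finset.range (m - 1), (10 * B ^ (m - i)) ^ Module.finrank ℚ F := by
  classical
  have hB' : ∀ k : ℕ, 1 ≤ B ^ k := fun k => one_le_pow₀ hB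
  let S : ℕ → Finset F := fun i => (ncard_integers_le F (hB' (m - i))).1.toFinset
  let I : Finset (Fin (m - 1) → F) := Fintype.piFinset fun i => S i
  have hmap : ∀ f ∈ polySet F m B, (fun i : Fin (m - 1) => f.coeff i) ∈ (I : Set _) := by
    intro f hf
    rw [Finset.mem_coe, Fintype.mem_piFinset]
    intro i
    rw [Set.Finite.mem_toFinset]
    exact hf.2.2.2 i (by omega)
  have hinj : Set.InjOn (fun (f : F[X]) (i : Fin (m - 1)) => f.coeff i) (polySet F m B) := by
    intro f hf g hg hfg
    ext i
    rcases lt_trichotomy i (m - 1) with hi | hi | hi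
    · exact congrFun hfg ⟨i, hi⟩
    · rcases Nat.eq_zero_or_pos m with hm | hm
      · have h1 : i = f.natDegree := by rw [hf.2.1]; omega
        have h2 : i = g.natDegree := by rw [hg.2.1]; omega
        have e1 := hf.1.coeff_natDegree
        have e2 := hg.1.coeff_natDegree
        rw [← h1] at e1
        rw [← h2] at e2
        rw [e1, e2]
      · have e1 := hf.2.2.1
        have e2 := hg.2.2.1
        rw [nextCoeff_of_natDegree_pos (by rw [hf.2.1]; exact hm), hf.2.1] at e1
        rw [nextCoeff_of_natDegree_pos (by rw [hg.2.1]; exact hm), hg.2.1] at e2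
        rw [hi, e1, e2]
    · rcases (show m ≤ i by omega).eq_or_lt with h | h
      · have e1 := hf.1.coeff_natDegree
        have e2 := hg.1.coeff_natDegree
        rw [hf.2.1, h] at e1
        rw [hg.2.1, h] at e2
        rw [e1, e2]
      · rw [coeff_eq_zero_of_natDegree_lt (by rw [hf.2.1]; exact h),
          coeff_eq_zero_of_natDegree_lt (by rw [hg.2.1]; exact h)]
  refine ⟨Set.Finite.of_finite_image (I.finite_toSet.subset (Set.image_subset_iff.2 hmap)) hinj, ?_⟩
  have h1 := Set.ncard_le_ncard_of_injOn _ hmap hinj I.finite_toSet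
  rw [Set.ncard_coe_finset, Fintype.card_piFinset] at h1
  refine (Nat.cast_le.2 h1).trans ?_
  rw [Finset.prod_range, Nat.cast_prod]
  refine Finset.prod_le_prod (fun _ _ => by positivity) fun i _ => ?_
  have := (ncard_integers_le F (hB' (m - i))).2
  rwa [Set.ncard_eq_toFinset_card _ (ncard_integers_le F (hB' (m - i))).1] at this

theorem minpoly_mem_polySet {m : ℕ} {B : ℝ} (hB : 1 ≤ B) {β : Qbar} (hβ : β ∈ elemSet F m B) :
    minpoly F β ∈ polySet F m (2 ^ m * B) := by
  have : Algebra.IsAlgebraic F Qbar := Algebra.IsAlgebraic.tower_top (K := ℚ) F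
  have h_integral : IsIntegral F β := Algebra.IsIntegral.isIntegral β
  have h_integral' : IsIntegral (𝓞 F) β := hβ.1.tower_top
  refine ⟨minpoly.monic h_integral, hβ.2.1, hβ.2.2.1, fun i hi => ⟨?_, fun τ => ?_⟩⟩
  · rw [minpoly.isIntegrallyClosed_eq_field_fractions' F h_integral', coeff_map]
    exact RingOfIntegers.isIntegral_coe _
  · have h1 := coeff_le_of_roots_le (p := minpoly F β) (f := τ) (B := B) i
      (minpoly.monic h_integral)
      (IsAlgClosed.splits _) (by
        intro z hz
        let := τ.toAlgebra
        have hz' : z ∈ (minpoly F β).rootSet ℂ := by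
          rw [mem_rootSet_of_ne (minpoly.ne_zero h_integral)]
          have := (mem_roots'.1 hz).2
          rwa [IsRoot, eval_map] at this
        rw [← Algebra.IsAlgebraic.range_eval_eq_rootSet_minpoly (A := ℂ) (K := Qbar)
          (F := F)] at hz'
        obtain ⟨ψ, rfl⟩ := hz'
        exact hβ.2.2.2 (ψ : Qbar →+* ℂ))
    rw [coeff_map, hβ.2.1] at h1
    refine h1.trans ?_
    rw [mul_pow, mul_comm]
    gcongr
    have h2 : ((m.choose i : ℕ) : ℝ) ≤ 2 ^ m := by
      exact_mod_cast Nat.choose_le_two_pow m i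
    have h3 : (2 : ℝ) ^ m ≤ (2 ^ m) ^ (m - i) :=
      le_self_pow₀ (one_le_pow₀ (by norm_num)) (by omega)
    linarith

theorem elemSet_ncard_le {m : ℕ} {B : ℝ} (hB : 1 ≤ B) : (elemSet F m B).Finite ∧
    ((elemSet F m B).ncard : ℝ) ≤
      m * ∏ i ∈ Finset.range (m - 1), (10 * (2 ^ m * B) ^ (m - i)) ^ Module.finrank ℚ F := by
  classical
  have : Algebra.IsAlgebraic F Qbar := Algebra.IsAlgebraic.tower_top (K := ℚ) F
  have hB' : 1 ≤ 2 ^ m * B := one_le_mul_of_one_le_of_one_le (one_le_pow₀ (by norm_num)) hB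
  obtain ⟨hfin, hcard⟩ := polySet_ncard_le F (m := m) hB'
  let J : Finset Qbar := hfin.toFinset.biUnion fun f => (f.map (algebraMap F Qbar)).roots.toFinset
  have hsub : elemSet F m B ⊆ J := by
    intro β hβ
    have h_integral : IsIntegral F β := Algebra.IsIntegral.isIntegral β
    rw [Finset.mem_coe, Finset.mem_biUnion]
    refine ⟨minpoly F β, hfin.mem_toFinset.2 (minpoly_mem_polySet F hB hβ), ?_⟩
    rw [Multiset.mem_toFinset, mem_roots (map_monic_ne_zero (minpoly.monic h_integral)), IsRoot,
      eval_map_algebraMap, minpoly.aeval]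
  refine ⟨J.finite_toSet.subset hsub, ?_⟩
  have h1 : (elemSet F m B).ncard ≤ J.card := by
    rw [← Set.ncard_coe_finset]
    exact Set.ncard_le_ncard hsub J.finite_toSet
  have h2 : J.card ≤ hfin.toFinset.card * m := by
    refine Finset.card_biUnion_le_card_mul _ _ _ fun f hf => ?_
    refine (Multiset.toFinset_card_le _).trans ((card_roots' _).trans ?_)
    rw [natDegree_map, (hfin.mem_toFinset.1 hf).2.1]
  rw [← Set.ncard_eq_toFinset_card _ hfin] at h2
  have h3 : ((elemSet F m B).ncard : ℝ) ≤ (polySet F m (2 ^ m * B)).ncard * m := by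
    exact_mod_cast h1.trans h2
  rw [mul_comm]
  refine h3.trans ?_
  gcongr
end

theorem exists_small_generator {F K : IntermediateField ℚ Qbar} (hFK : F ≤ K) {n d : ℕ}
    (hn : Module.finrank ℚ K = n) (hd : Module.finrank ℚ F = d) (hd0 : 0 < d) (hdn : d < n)
    {X : ℝ} (hX : 1 ≤ X) (hD : |(fieldDiscr K : ℝ)| ≤ X) :
    ∃ β ∈ K, β ∉ F ∧ IsIntegral ℤ β ∧ (minpoly F β).nextCoeff = 0 ∧
      ∀ φ : Qbar →+* ℂ, ‖φ β‖ ≤ 2 * (3 * n + 1) ^ n * X ^ (1 / (2 * ((n : ℝ) - d))) := by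
  have hdn' : (0 : ℝ) < n - d := sub_pos.2 (by exact_mod_cast hdn)
  have hfK : FiniteDimensional ℚ K := FiniteDimensional.of_finrank_pos (by omega)
  have hfF : FiniteDimensional ℚ F := FiniteDimensional.of_finrank_pos (by omega)
  have : NumberField K := ⟨⟩
  have : NumberField F := ⟨⟩
  let : Algebra F K := (IntermediateField.inclusion hFK).toAlgebra
  have : IsScalarTower F K Qbar := IsScalarTower.of_algebraMap_eq fun x => rfl
  set A : ℝ := (3 * n + 1) ^ n * X ^ (1 / (2 * ((n : ℝ) - d))) with hA
  have hC1 : (1 : ℝ) ≤ (3 * n + 1) ^ n := one_le_pow₀ (by linarith [Nat.cast_nonneg (α := ℝ) n])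
  have hA1 : 1 ≤ A :=
    one_le_mul_of_one_le_of_one_le hC1 (Real.one_le_rpow hX (by positivity))
  have hApow : (X ^ (1 / (2 * ((n : ℝ) - d)))) ^ (n - d) = √X := by
    rw [← Real.rpow_natCast, ← Real.rpow_mul (by linarith), Nat.cast_sub hdn.le, Real.sqrt_eq_rpow]
    congr 1
    field_simp
  have hdisc : √|(discr K : ℝ)| ≤ √X := by
    apply Real.sqrt_le_sqrt
    rw [fieldDiscr, dif_pos hfK] at hD
    exact hD
  have key : √|(discr K : ℝ)| * (3 * Module.finrank ℚ K * A) ^ Module.finrank ℚ F <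
      A ^ Module.finrank ℚ K := by
    rw [hn, hd, ← Nat.sub_add_cancel hdn.le, pow_add _ (n - d), Nat.sub_add_cancel hdn.le,
      mul_pow _ A,
      ← mul_assoc]
    have hs : 0 < √X := Real.sqrt_pos.2 (by linarith)
    refine mul_lt_mul_of_pos_right ?_ (by positivity)
    refine (mul_le_mul_of_nonneg_right hdisc (by positivity)).trans_lt ?_
    rw [hA, mul_pow ((3 * n + 1 : ℝ) ^ n), hApow, mul_comm]
    refine mul_lt_mul_of_pos_right ?_ hs
    calc (3 * n : ℝ) ^ d < (3 * n + 1) ^ d := by gcongr; linarith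
      _ ≤ (3 * n + 1) ^ n := by
        gcongr
        linarith [Nat.cast_nonneg (α := ℝ) n]
      _ ≤ ((3 * n + 1) ^ n) ^ (n - d) := le_self_pow₀ hC1 (by omega)
  obtain ⟨β, hβ0, hβi, hβt, hβ⟩ := exists_small_trace_zero F K A hA1 key
  have hmp : minpoly F (β : Qbar) = minpoly F β :=
    minpoly.algebraMap_eq (algebraMap K Qbar).injective β
  have htr := trace_eq_finrank_mul_minpoly_nextCoeff F β
  rw [hβt, eq_comm, mul_eq_zero, neg_eq_zero] at htr
  have hne : (minpoly F β).nextCoeff = 0 := by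
    refine htr.resolve_left ?_
    have : 0 < Module.finrank (IntermediateField.adjoin F {β}) K := Module.finrank_pos
    exact_mod_cast this.ne'
  refine ⟨β, β.2, ?_, ?_, by rw [hmp, hne], ?_⟩
  · intro hF
    have : β = algebraMap F K ⟨β, hF⟩ := rfl
    rw [this, minpoly.eq_X_sub_C, nextCoeff_X_sub_C, neg_eq_zero] at hne
    apply hβ0
    rw [this, hne, map_zero]
  · exact map_isIntegral_int (algebraMap K Qbar) hβi
  · intro φ
    have := hβ (φ.comp (algebraMap K Qbar))
    rw [mul_assoc]
    exact this

theorem ncard_biUnion_le_mul {ι α : Type*} {T : Set ι} {f : ι → Set α} {a b : ℝ} (hT : T.Finite)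
    (hTa : (T.ncard : ℝ) ≤ a) (hb : 0 ≤ b) (hf : ∀ i ∈ T, (f i).Finite ∧ ((f i).ncard : ℝ) ≤ b) :
    (⋃ i ∈ T, f i).Finite ∧ ((⋃ i ∈ T, f i).ncard : ℝ) ≤ a * b := by
  classical
  refine ⟨hT.biUnion fun i hi => (hf i hi).1, ?_⟩
  have h1 : (⋃ i ∈ T, f i) = ⋃ i ∈ hT.toFinset, f i := by simp
  have h2 : ((⋃ i ∈ T, f i).ncard : ℝ) ≤ ∑ i ∈ hT.toFinset, ((f i).ncard : ℝ) := by
    rw [h1]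
    exact_mod_cast Finset.set_ncard_biUnion_le hT.toFinset f
  refine h2.trans ((Finset.sum_le_card_nsmul _ _ b fun i hi =>
    (hf i (by simpa using hi)).2).trans ?_)
  rw [← Set.ncard_eq_toFinset_card _ hT, nsmul_eq_mul]
  gcongr

theorem exists_bound_biUnion {ι P α : Type*} (I : Finset ι) (S : ι → P → Set α) (g : P → ℝ)
    (p : P → Prop)
    (h : ∀ i ∈ I, ∃ C : ℝ, 0 ≤ C ∧ ∀ x, p x → (S i x).Finite ∧ ((S i x).ncard : ℝ) ≤ C * g x) :
    ∃ C : ℝ, 0 ≤ C ∧ ∀ x, p x → (⋃ i ∈ I, S i x).Finite ∧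
      ((⋃ i ∈ I, S i x).ncard : ℝ) ≤ C * g x := by
  classical
  choose! C hC0 hC using h
  refine ⟨∑ i ∈ I, C i, Finset.sum_nonneg hC0, fun x hx => ?_⟩
  refine ⟨I.finite_toSet.biUnion fun i hi => (hC i hi x hx).1, ?_⟩
  have h2 : ((⋃ i ∈ I, S i x).ncard : ℝ) ≤ ∑ i ∈ I, ((S i x).ncard : ℝ) := by
    exact_mod_cast Finset.set_ncard_biUnion_le I fun i => S i x
  refine h2.trans ?_
  rw [Finset.sum_mul]
  exact Finset.sum_le_sum fun i hi => (hC i hi x hx).2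

/-- The fields of degree `n` and absolute discriminant at most `X` containing `F`. -/
noncomputable def fieldsOver (F : IntermediateField ℚ Qbar) (n : ℕ) (X : ℝ) :
    Set (IntermediateField ℚ Qbar) :=
  {K | F ≤ K ∧ Module.finrank ℚ K = n ∧ |(fieldDiscr K : ℝ)| ≤ X}

/-- The field `F(β)`, as a subfield of `ℚ̄`. -/
noncomputable def adjoinElem (F : IntermediateField ℚ Qbar) (β : Qbar) : IntermediateField ℚ Qbar :=
  (IntermediateField.adjoin F {β}).restrictScalars ℚ

theorem mem_adjoinElem (F : IntermediateField ℚ Qbar) (β : Qbar) : β ∈ adjoinElem F β :=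
  IntermediateField.mem_adjoin_simple_self F β

theorem adjoinElem_le {F K : IntermediateField ℚ Qbar} (hFK : F ≤ K) {β : Qbar} (hβ : β ∈ K) :
    adjoinElem F β ≤ K := by
  have : IntermediateField.adjoin F {β} ≤ IntermediateField.extendScalars hFK := by
    rw [IntermediateField.adjoin_simple_le_iff]
    exact hβ
  exact this

theorem finrank_adjoinElem (F : IntermediateField ℚ Qbar) [FiniteDimensional ℚ F] (β : Qbar) :
    Module.finrank ℚ (adjoinElem F β) = Module.finrank ℚ F * (minpoly F β).natDegree := by
  have h_integral : IsIntegral F β := Algebra.IsIntegral.isIntegral β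
  rw [← IntermediateField.adjoin.finrank h_integral]
  exact (Module.finrank_mul_finrank ℚ F (IntermediateField.adjoin F {β})).symm

/-- The size of a generator of relative trace zero of a field of degree `n` and absolute
discriminant `X` over a subfield of degree `d`. -/
noncomputable def genBound (n d : ℕ) (X : ℝ) : ℝ :=
  2 * (3 * n + 1) ^ n * X ^ (1 / (2 * ((n : ℝ) - d)))

theorem one_le_genBound {n d : ℕ} (hd : d < n) {X : ℝ} (hX : 1 ≤ X) : 1 ≤ genBound n d X := by
  have hdn' : (0 : ℝ) < n - d := sub_pos.2 (by exact_mod_cast hd)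
  have hC1 : (1 : ℝ) ≤ (3 * n + 1) ^ n := one_le_pow₀ (by linarith [Nat.cast_nonneg (α := ℝ) n])
  exact one_le_mul_of_one_le_of_one_le (by linarith) (Real.one_le_rpow hX (by positivity))

theorem fieldsOver_subset {F : IntermediateField ℚ Qbar} {n d : ℕ} (hd : Module.finrank ℚ F = d)
    (hd0 : 0 < d) (hdn : d < n) {X : ℝ} (hX : 1 ≤ X) :
    fieldsOver F n X ⊆ ⋃ m ∈ (Finset.Icc 2 n).filter (fun m => d * m ∣ n),
      ⋃ β ∈ elemSet F m (genBound n d X), fieldsOver (adjoinElem F β) n X := by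
  rintro K ⟨hFK, hn, hD⟩
  have hfF : FiniteDimensional ℚ F := FiniteDimensional.of_finrank_pos (by omega)
  have hfK : FiniteDimensional ℚ K := FiniteDimensional.of_finrank_pos (by omega)
  obtain ⟨β, hβK, hβF, hβi, hβn, hβ⟩ := exists_small_generator hFK hn hd hd0 hdn hX hD
  have h_integral : IsIntegral F β := Algebra.IsIntegral.isIntegral β
  have hle := adjoinElem_le hFK hβK
  have hdvd : d * (minpoly F β).natDegree ∣ n := by
    have := finrank_adjoinElem F β
    rw [hd] at this
    rw [← this, ← hn]
    exact IntermediateField.finrank_dvd_of_le_right hle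
  have h2 : 2 ≤ (minpoly F β).natDegree := by
    rw [minpoly.two_le_natDegree_iff h_integral]
    rintro ⟨x, rfl⟩
    exact hβF x.2
  simp only [Set.mem_iUnion]
  refine ⟨_, Finset.mem_filter.2 ⟨Finset.mem_Icc.2 ⟨h2, ?_⟩, hdvd⟩, β,
    ⟨hβi, rfl, hβn, hβ⟩, hle, hn, hD⟩
  exact Nat.le_of_dvd (by omega) (dvd_of_mul_left_dvd hdvd)

theorem sum_range_sub_eq {m : ℕ} (hm : 1 ≤ m) :
    ((∑ i ∈ Finset.range (m - 1), (m - i) : ℕ) : ℝ) = ((m : ℝ) + 2) * (m - 1) / 2 := by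
  obtain ⟨k, rfl⟩ : ∃ k, m = k + 1 := ⟨m - 1, by omega⟩
  rw [← Finset.sum_range_reflect]
  have : ∀ i ∈ Finset.range (k + 1 - 1), k + 1 - (k + 1 - 1 - 1 - i) = i + 2 := by
    intro i hi
    rw [Finset.mem_range] at hi
    omega
  rw [Finset.sum_congr rfl this]
  clear this hm
  simp only [Nat.add_sub_cancel]
  induction k with
  | zero => simp
  | succ k ih =>
    rw [Finset.sum_range_succ, Nat.cast_add, ih]
    push_cast
    ring

theorem fieldsOver_self_le {F : IntermediateField ℚ Qbar} {n : ℕ} (hn : 0 < n)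
    (hd : Module.finrank ℚ F = n) (X : ℝ) :
    (fieldsOver F n X).Finite ∧ ((fieldsOver F n X).ncard : ℝ) ≤ 1 := by
  have : fieldsOver F n X ⊆ {F} := by
    rintro K ⟨hFK, hK, -⟩
    have : FiniteDimensional ℚ K := FiniteDimensional.of_finrank_pos (by omega)
    exact (IntermediateField.eq_of_le_of_finrank_eq hFK (hd.trans hK.symm)).symm
  refine ⟨(Set.finite_singleton F).subset this, ?_⟩
  have := Set.ncard_le_ncard this
  rw [Set.ncard_singleton] at this
  exact_mod_cast this

theorem exists_bound_elemSet_fields {n d m : ℕ} (hd0 : 0 < d) (hdn : d < n) (hm : 2 ≤ m) {e : ℝ}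
    (H : ∃ C : ℝ, 0 ≤ C ∧ ∀ x : IntermediateField ℚ Qbar × ℝ,
      (Module.finrank ℚ x.1 = d * m ∧ 1 ≤ x.2) →
      (fieldsOver x.1 n x.2).Finite ∧ ((fieldsOver x.1 n x.2).ncard : ℝ) ≤ C * x.2 ^ e) :
    ∃ C : ℝ, 0 ≤ C ∧ ∀ x : IntermediateField ℚ Qbar × ℝ,
      (Module.finrank ℚ x.1 = d ∧ 1 ≤ x.2) →
      (⋃ β ∈ elemSet x.1 m (genBound n d x.2), fieldsOver (adjoinElem x.1 β) n x.2).Finite ∧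
      ((⋃ β ∈ elemSet x.1 m (genBound n d x.2), fieldsOver (adjoinElem x.1 β) n x.2).ncard : ℝ) ≤
        C * x.2 ^ (((m : ℝ) + 2) * (m - 1) * d / (4 * (n - d)) + e) := by
  obtain ⟨C, hC0, hC⟩ := H
  have hdn' : (0 : ℝ) < n - d := sub_pos.2 (by exact_mod_cast hdn)
  let c : ℝ := 2 * (3 * n + 1) ^ n
  refine ⟨(m * ∏ i ∈ Finset.range (m - 1), (10 * (2 ^ m * c) ^ (m - i)) ^ d) * C, by positivity, ?_⟩
  rintro ⟨F, X⟩ ⟨hF, hX⟩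
  simp only at hF hX ⊢
  have hfF : FiniteDimensional ℚ F := FiniteDimensional.of_finrank_pos (by omega)
  have : NumberField F := ⟨⟩
  obtain ⟨h1, h2⟩ := elemSet_ncard_le F (m := m) (one_le_genBound hdn hX)
  have hX0 : 0 < X := by linarith
  obtain ⟨h3, h4⟩ := ncard_biUnion_le_mul h1 h2 (b := C * X ^ e) (by positivity)
    (f := fun β => fieldsOver (adjoinElem F β) n X) (fun β hβ => hC ⟨adjoinElem F β, X⟩ ⟨by
      simp only
      rw [finrank_adjoinElem, hF, hβ.2.1], hX⟩)
  refine ⟨h3, h4.trans (le_of_eq ?_)⟩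
  rw [Real.rpow_add hX0, hF]
  have h5 : ∀ i, (10 * (2 ^ m * genBound n d X) ^ (m - i)) ^ d = (10 * (2 ^ m * c) ^ (m - i)) ^ d *
      ((X ^ (1 / (2 * ((n : ℝ) - d)))) ^ d) ^ (m - i) := by
    intro i
    simp only [genBound, c]
    rw [← mul_assoc, mul_pow _ (X ^ _), ← mul_assoc, mul_pow _ _ d]
    ring
  simp_rw [h5]
  rw [Finset.prod_mul_distrib, Finset.prod_pow_eq_pow_sum]
  have h6 : ((X ^ (1 / (2 * ((n : ℝ) - d)))) ^ d) ^ (∑ i ∈ Finset.range (m - 1), (m - i)) =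
      X ^ (((m : ℝ) + 2) * (m - 1) * d / (4 * (n - d))) := by
    rw [← Real.rpow_natCast, ← Real.rpow_natCast, ← Real.rpow_mul hX0.le, ← Real.rpow_mul hX0.le,
      sum_range_sub_eq (by omega)]
    congr 1
    field_simp
    ring
  rw [h6]
  ring

theorem exists_bound_fieldsOver {n : ℕ} : ∀ k d : ℕ, n - d = k → 0 < d → d < n →
    ∃ C : ℝ, 0 ≤ C ∧ ∀ x : IntermediateField ℚ Qbar × ℝ,
      (Module.finrank ℚ x.1 = d ∧ 1 ≤ x.2) →
      (fieldsOver x.1 n x.2).Finite ∧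
        ((fieldsOver x.1 n x.2).ncard : ℝ) ≤ C * x.2 ^ (((n : ℝ) / d + 2) / 4) := by
  intro k
  induction k using Nat.strong_induction_on with
  | _ k ih =>
  intro d hk hd0 hdn
  have hdn' : (0 : ℝ) < n - d := sub_pos.2 (by exact_mod_cast hdn)
  have main : ∀ m ∈ (Finset.Icc 2 n).filter (fun m => d * m ∣ n), ∃ C : ℝ, 0 ≤ C ∧
      ∀ x : IntermediateField ℚ Qbar × ℝ, (Module.finrank ℚ x.1 = d ∧ 1 ≤ x.2) →
      (⋃ β ∈ elemSet x.1 m (genBound n d x.2), fieldsOver (adjoinElem x.1 β) n x.2).Finite ∧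
      ((⋃ β ∈ elemSet x.1 m (genBound n d x.2), fieldsOver (adjoinElem x.1 β) n x.2).ncard : ℝ) ≤
        C * (max x.2 1) ^ (((n : ℝ) / d + 2) / 4) := by
    intro m hm
    rw [Finset.mem_filter, Finset.mem_Icc] at hm
    obtain ⟨⟨hm2, -⟩, M, hM⟩ := hm
    have hd0' : (0 : ℝ) < d := by exact_mod_cast hd0
    have hm2' : (2 : ℝ) ≤ m := by exact_mod_cast hm2
    have hM' : (n : ℝ) = d * m * M := by exact_mod_cast hM
    have hM0 : 0 < M := Nat.pos_of_ne_zero (by rintro rfl; omega)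
    have hM0' : (1 : ℝ) ≤ M := by exact_mod_cast hM0
    have hmM : (0 : ℝ) < m * M - 1 := by nlinarith
    obtain ⟨e, he, H⟩ : ∃ e : ℝ, ((m : ℝ) + 2) * (m - 1) * d / (4 * (n - d)) + e ≤
        ((n : ℝ) / d + 2) / 4 ∧ ∃ C : ℝ, 0 ≤ C ∧ ∀ x : IntermediateField ℚ Qbar × ℝ,
        (Module.finrank ℚ x.1 = d * m ∧ 1 ≤ x.2) →
        (fieldsOver x.1 n x.2).Finite ∧ ((fieldsOver x.1 n x.2).ncard : ℝ) ≤ C * x.2 ^ e := by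
      have e1 : ((m : ℝ) + 2) * (m - 1) * d / (4 * (n - d)) =
          (m + 2) * (m - 1) / (4 * (m * M - 1)) := by
        rw [hM', show 4 * ((d : ℝ) * m * M - d) = (4 * (m * M - 1)) * d by ring,
          mul_div_mul_right _ _ hd0'.ne']
      have e2 : (n : ℝ) / d = m * M := by
        rw [hM']; field_simp
      rw [e1, e2]
      rcases (show 1 ≤ M from hM0).eq_or_lt with h | h
      · subst h
        rw [mul_one] at hM
        refine ⟨0, ?_, 1, zero_le_one, fun x hx => ?_⟩
        · rw [Nat.cast_one, mul_one, add_zero, div_le_div_iff₀ (by linarith) (by norm_num)]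
          linarith
        · rw [Real.rpow_zero, mul_one]
          exact fieldsOver_self_le (by omega) (hx.1.trans hM.symm) x.2
      · have hM2 : (2 : ℝ) ≤ M := by exact_mod_cast h
        have h1 : d < d * m := lt_mul_of_one_lt_right hd0 (by omega)
        have h2 : d * m < n := by
          rw [hM]; exact lt_mul_of_one_lt_right (by positivity) h
        refine ⟨_, ?_, ih (n - d * m) (by omega) (d * m) rfl (by omega) h2⟩
        have e3 : (n : ℝ) / (d * m : ℕ) = M := by
          rw [hM']; push_cast; field_simp
        rw [e3]
        have : ((m : ℝ) + 2) * (m - 1) / (4 * (m * M - 1)) ≤ (m - 1) * M / 4 := by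
          rw [div_le_div_iff₀ (by linarith) (by norm_num)]
          nlinarith [mul_nonneg (sub_nonneg.2 hm2') (sub_nonneg.2 hM2),
            mul_nonneg (show (0 : ℝ) ≤ m - 1 by linarith) (show 0 ≤ M * (m * M - 1) - (m + 2 : ℝ) by
              nlinarith [mul_nonneg (sub_nonneg.2 hm2') (sub_nonneg.2 hM2)])]
        linarith
    obtain ⟨C, hC0, hC⟩ := exists_bound_elemSet_fields hd0 hdn hm2 H
    refine ⟨C, hC0, fun x hx => ⟨(hC x hx).1, (hC x hx).2.trans ?_⟩⟩
    rw [max_eq_left hx.2]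
    gcongr
    exact hx.2
  obtain ⟨C, hC0, hC⟩ := exists_bound_biUnion _ _ _ _ main
  refine ⟨C, hC0, fun x hx => ?_⟩
  have h1 := hC x hx
  rw [max_eq_left hx.2] at h1
  have h2 := fieldsOver_subset (n := n) hx.1 hd0 hdn hx.2
  refine ⟨h1.1.subset h2, le_trans ?_ h1.2⟩
  exact_mod_cast Set.ncard_le_ncard h2 h1.1

/-- The Fejér kernel on `ZMod M` of order `N`. -/
noncomputable def fejer (M N : ℕ) [NeZero M] (t : ZMod M) : ℝ :=
  ‖∑ j ∈ Finset.range N, ZMod.stdAddChar ((j : ZMod M) * t)‖ ^ 2 / (N : ℝ) ^ 2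

theorem fejer_nonneg (M N : ℕ) [NeZero M] (t : ZMod M) : 0 ≤ fejer M N t := by
  unfold fejer; positivity

theorem one_div_four_le_fejer {M N T : ℕ} [NeZero M] (hN : 0 < N) (hM : M = N * (6 * T)) {t : ℤ}
    (ht : |t| ≤ T) : 1 / 4 ≤ fejer M N (t : ZMod M) := by
  have hM0 : (0 : ℝ) < M := Nat.cast_pos.2 (NeZero.pos M)
  have hN' : (0 : ℝ) < N := Nat.cast_pos.2 hN
  have h1 : ∀ j ∈ Finset.range N, (1 / 2 : ℝ) ≤
      (ZMod.stdAddChar ((j : ZMod M) * (t : ZMod M))).re := by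
    intro j hj
    have hj' : (j : ℝ) ≤ N := by
      rw [Finset.mem_range] at hj
      exact_mod_cast hj.le
    have e1 : ((j : ZMod M) * (t : ZMod M)) = ((j * t : ℤ) : ZMod M) := by push_cast; rfl
    rw [e1, ZMod.stdAddChar_coe]
    have e2 : 2 * (Real.pi : ℂ) * Complex.I * ((j * t : ℤ) : ℂ) / (M : ℂ) =
        ((2 * Real.pi * (j * t / M) : ℝ) : ℂ) * Complex.I := by
      push_cast; ring
    rw [e2, Complex.exp_ofReal_mul_I_re, ← Real.cos_pi_div_three, ← Real.cos_abs (2 * _ * _)]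
    have h3 : |(t : ℝ)| ≤ T := by exact_mod_cast ht
    have h2 : |(j : ℝ) * t / M| ≤ 1 / 6 := by
      rw [abs_div, abs_mul, Nat.abs_cast, abs_of_pos hM0, div_le_div_iff₀ hM0 (by norm_num), hM]
      push_cast
      have : (j : ℝ) * |(t : ℝ)| ≤ N * T := by gcongr
      linarith
    refine Real.cos_le_cos_of_nonneg_of_le_pi (abs_nonneg _) (by linarith [Real.pi_pos]) ?_
    rw [abs_mul, abs_of_pos (by positivity : 0 < 2 * Real.pi)]
    calc 2 * Real.pi * |(j : ℝ) * t / M| ≤ 2 * Real.pi * (1 / 6) := by gcongr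
      _ = Real.pi / 3 := by ring
  have h2 : (N : ℝ) / 2 ≤
      ‖∑ j ∈ Finset.range N, ZMod.stdAddChar ((j : ZMod M) * (t : ZMod M))‖ := by
    refine le_trans ?_ (Complex.re_le_norm _)
    rw [Complex.re_sum]
    refine le_trans ?_ (Finset.sum_le_sum h1)
    simp
    linarith
  rw [fejer, div_le_div_iff₀ (by norm_num) (by positivity)]
  nlinarith [sq_nonneg
    (‖∑ j ∈ Finset.range N, ZMod.stdAddChar ((j : ZMod M) * (t : ZMod M))‖ - N / 2)]

section
variable {A : Type*} [AddCommGroup A] [Fintype A] [DecidableEq A]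

theorem sum_stdAddChar_fiber {M : ℕ} [NeZero M] (f : ZMod M →+ A) (u : A) {k : ℤ}
    (hk : k ≠ 0) (hkM : |k| * Fintype.card A < M) :
    ∑ t with f t = u, ZMod.stdAddChar ((k : ZMod M) * t) = 0 := by
  set q := Fintype.card A with hq
  have hq0 : 0 < q := Fintype.card_pos_iff.2 ⟨0⟩
  have hfq : f (q : ZMod M) = 0 := by
    have : (q : ZMod M) = q • 1 := by simp
    rw [this, map_nsmul, hq, card_nsmul_eq_zero]
  set S := ∑ t with f t = u, ZMod.stdAddChar ((k : ZMod M) * t) with hS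
  have h1 : S = ZMod.stdAddChar ((k : ZMod M) * (q : ZMod M)) * S := by
    rw [hS, Finset.mul_sum]
    refine Finset.sum_bij' (fun t _ => t - q) (fun t _ => t + q) ?_ ?_ ?_ ?_ ?_
    · intro t ht
      simp only [Finset.mem_filter, Finset.mem_univ, true_and] at ht ⊢
      rw [map_sub, ht, hfq, sub_zero]
    · intro t ht
      simp only [Finset.mem_filter, Finset.mem_univ, true_and] at ht ⊢
      rw [map_add, ht, hfq, add_zero]
    · intro t _; simp
    · intro t _; simp
    · intro t _
      rw [← AddChar.map_add_eq_mul]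
      congr 1
      ring
  by_contra h0
  have h2 : ZMod.stdAddChar ((k : ZMod M) * (q : ZMod M)) = 1 := by
    exact mul_right_cancel₀ h0 (by rw [one_mul, ← h1])
  rw [← AddChar.map_zero_eq_one (ZMod.stdAddChar (N := M))] at h2
  have h3 := ZMod.injective_stdAddChar h2
  have h4 : ((k * q : ℤ) : ZMod M) = 0 := by push_cast; exact h3
  rw [ZMod.intCast_zmod_eq_zero_iff_dvd] at h4
  have h5 := Int.le_of_dvd (abs_pos.2 (mul_ne_zero hk (by exact_mod_cast hq0.ne')))
    ((dvd_abs _ _).2 h4)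
  rw [abs_mul, Nat.abs_cast] at h5
  exact absurd hkM (not_lt.2 h5)

theorem card_fiber_mul {M : ℕ} [NeZero M] {f : ZMod M →+ A} (hf : Function.Surjective f) (u : A) :
    (Finset.univ.filter fun t => f t = u).card * Fintype.card A = M := by
  have h1 := Finset.card_eq_sum_card_fiberwise (f := f) (s := Finset.univ) (t := Finset.univ)
    (fun _ _ => by simp)
  rw [Finset.sum_congr rfl fun b _ => AddMonoidHom.card_fiber_eq_of_mem_range f (hf b) (hf u)] at h1
  rw [Finset.card_univ, ZMod.card, Finset.sum_const, Finset.card_univ, smul_eq_mul] at h1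
  rw [mul_comm]
  exact h1.symm

theorem sum_fejer_fiber {M N : ℕ} [NeZero M] (hN : 0 < N) {f : ZMod M →+ A}
    (hf : Function.Surjective f) (u : A) (hM : N * Fintype.card A ≤ M) :
    ∑ t with f t = u, fejer M N t = M / (N * Fintype.card A) := by
  have hN' : (N : ℝ) ≠ 0 := Nat.cast_ne_zero.2 hN.ne'
  have hq0 : 0 < Fintype.card A := Fintype.card_pos_iff.2 ⟨0⟩
  have h1 : ∀ t : ZMod M, ((fejer M N t : ℝ) : ℂ) = (1 / (N : ℂ) ^ 2) *
      ∑ j ∈ Finset.range N, ∑ k ∈ Finset.range N,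
        ZMod.stdAddChar (((j - k : ℤ) : ZMod M) * t) := by
    intro t
    rw [fejer, ← Complex.normSq_eq_norm_sq, Complex.ofReal_div, ← Complex.mul_conj, map_sum,
      Finset.sum_mul_sum, div_eq_mul_one_div, mul_comm]
    push_cast
    congr 1
    refine Finset.sum_congr rfl fun j _ => Finset.sum_congr rfl fun k _ => ?_
    rw [← AddChar.map_neg_eq_conj, ← AddChar.map_add_eq_mul]
    congr 1
    ring
  have h2 : ((∑ t with f t = u, fejer M N t : ℝ) : ℂ) = ((M / (N * Fintype.card A) : ℝ) : ℂ) := by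
    rw [Complex.ofReal_sum]
    simp_rw [h1]
    rw [← Finset.mul_sum, Finset.sum_comm]
    have h3 : ∀ j ∈ Finset.range N, ∑ t with f t = u, ∑ k ∈ Finset.range N,
        ZMod.stdAddChar (((j - k : ℤ) : ZMod M) * t) = (M : ℂ) / Fintype.card A := by
      intro j hj
      rw [Finset.sum_comm, Finset.sum_eq_single_of_mem j hj]
      · have h4 := card_fiber_mul hf u
        simp only [sub_self, Int.cast_zero, zero_mul, AddChar.map_zero_eq_one, Finset.sum_const,
          nsmul_eq_mul, mul_one]
        rw [eq_div_iff (by exact_mod_cast hq0.ne')]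
        exact_mod_cast h4
      · intro k hk hkj
        rw [Finset.mem_range] at hj hk
        refine sum_stdAddChar_fiber f u (by omega) ?_
        have : |(j : ℤ) - k| < N := by rw [abs_lt]; omega
        calc |(j : ℤ) - k| * Fintype.card A < N * Fintype.card A := by
              gcongr
          _ ≤ M := by exact_mod_cast hM
    rw [Finset.sum_congr rfl h3, Finset.sum_const, Finset.card_range, nsmul_eq_mul]
    push_cast
    have : (N : ℂ) ≠ 0 := Nat.cast_ne_zero.2 hN.ne'
    field_simp
  exact_mod_cast h2

variable {ι : Type*} [Fintype ι] [DecidableEq ι]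

theorem sum_prod_fejer {M : ℕ} [NeZero M] {N : ι → ℕ} (hN : ∀ i, 0 < N i) {f : ZMod M →+ A}
    (hf : Function.Surjective f) (hM : ∀ i, N i * Fintype.card A ≤ M) (U : Finset (ι → A)) :
    ∑ t with f ∘ t ∈ U, ∏ i, fejer M (N i) (t i) =
      (∏ i, ((M : ℝ) / N i)) * (U.card / (Fintype.card A : ℝ) ^ Fintype.card ι) := by
  have h1 : ∀ u : ι → A, ∑ t with f ∘ t = u, ∏ i, fejer M (N i) (t i) =
      (∏ i, ((M : ℝ) / N i)) / (Fintype.card A : ℝ) ^ Fintype.card ι := by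
    intro u
    have h2 : (Finset.univ.filter fun t : ι → ZMod M => f ∘ t = u) =
        Fintype.piFinset fun i => Finset.univ.filter fun x => f x = u i := by
      ext t
      simp [Fintype.mem_piFinset, funext_iff]
    rw [h2, ← Finset.prod_univ_sum]
    rw [Finset.prod_congr rfl fun i _ => sum_fejer_fiber (hN i) hf (u i) (hM i)]
    rw [← Finset.card_univ (α := ι), ← Finset.prod_const, ← Finset.prod_div_distrib]
    exact Finset.prod_congr rfl fun i _ => by rw [div_div]
  have h3 : (Finset.univ.filter fun t : ι → ZMod M => f ∘ t ∈ U) =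
      U.biUnion fun u => Finset.univ.filter fun t => f ∘ t = u := by
    ext t; simp
  rw [h3, Finset.sum_biUnion, Finset.sum_congr rfl fun u _ => h1 u, Finset.sum_const, nsmul_eq_mul]
  · ring
  · intro u _ v _ huv
    simp only [Function.onFun, Finset.disjoint_left, Finset.mem_filter, Finset.mem_univ, true_and]
    intro t h1 h2
    exact huv (h1.symm.trans h2)
end

section
variable {ι : Type*} [Fintype ι] [DecidableEq ι]

theorem sum_prod_fejer_zmod {M : ℕ} [NeZero M] {N : ι → ℕ} (hN : ∀ i, 0 < N i) {p : ℕ}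
    (hp : p ∣ M) (hM : ∀ i, N i * p ≤ M) (U : Finset (ι → ZMod p)) :
    ∑ t with ZMod.castHom hp (ZMod p) ∘ t ∈ U, ∏ i, fejer M (N i) (t i) =
      (∏ i, ((M : ℝ) / N i)) * (U.card / (p : ℝ) ^ Fintype.card ι) := by
  have : NeZero p := ⟨by rintro rfl; exact NeZero.ne M (zero_dvd_iff.1 hp)⟩
  have h := sum_prod_fejer hN (f := (ZMod.castHom hp (ZMod p)).toAddMonoidHom)
    (ZMod.castHom_surjective hp) (by simpa [ZMod.card] using hM) U
  rw [ZMod.card] at h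
  exact h

theorem sum_prod_fejer_zmod_two {M : ℕ} [NeZero M] {N : ι → ℕ} (hN : ∀ i, 0 < N i) {p q : ℕ}
    (hpq : p.Coprime q) (hp : p ∣ M) (hq : q ∣ M) (hM : ∀ i, N i * (p * q) ≤ M)
    (U : Finset (ι → ZMod p)) (V : Finset (ι → ZMod q)) :
    ∑ t with ZMod.castHom hp (ZMod p) ∘ t ∈ U ∧ ZMod.castHom hq (ZMod q) ∘ t ∈ V,
        ∏ i, fejer M (N i) (t i) =
      (∏ i, ((M : ℝ) / N i)) *
        ((U.card / (p : ℝ) ^ Fintype.card ι) * (V.card / (q : ℝ) ^ Fintype.card ι)) := by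
  have : NeZero p := ⟨by rintro rfl; exact NeZero.ne M (zero_dvd_iff.1 hp)⟩
  have : NeZero q := ⟨by rintro rfl; exact NeZero.ne M (zero_dvd_iff.1 hq)⟩
  let f : ZMod M →+ ZMod p × ZMod q :=
    (ZMod.castHom hp (ZMod p)).toAddMonoidHom.prod (ZMod.castHom hq (ZMod q)).toAddMonoidHom
  have hf : Function.Surjective f := by
    intro x
    obtain ⟨y, hy⟩ := (ZMod.chineseRemainder hpq).surjective x
    obtain ⟨z, hz⟩ := ZMod.castHom_surjective (hpq.mul_dvd_of_dvd_of_dvd hp hq) y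
    refine ⟨z, ?_⟩
    have h1 : ((ZMod.chineseRemainder hpq).toRingHom.comp
        (ZMod.castHom (hpq.mul_dvd_of_dvd_of_dvd hp hq) _)) =
        (ZMod.castHom hp (ZMod p)).prod (ZMod.castHom hq (ZMod q)) := RingHom.ext_zmod _ _
    have h2 := congrArg (fun g => g z) h1
    simp only [RingHom.comp_apply, hz] at h2
    rw [← hy]
    exact h2.symm
  let e := Equiv.arrowProdEquivProdArrow ι (fun _ => ZMod p) (fun _ => ZMod q)
  have h := sum_prod_fejer hN hf (by simpa [ZMod.card] using hM) ((U ×ˢ V).map e.symm.toEmbedding)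
  rw [Finset.card_map, Finset.card_product, Fintype.card_prod, ZMod.card, ZMod.card] at h
  have h3 : (Finset.univ.filter fun t : ι → ZMod M =>
      ZMod.castHom hp (ZMod p) ∘ t ∈ U ∧ ZMod.castHom hq (ZMod q) ∘ t ∈ V) =
      Finset.univ.filter fun t => f ∘ t ∈ (U ×ˢ V).map e.symm.toEmbedding := by
    ext t
    rw [Finset.mem_filter, Finset.mem_filter, Finset.mem_map_equiv, Finset.mem_product]
    rfl
  rw [h3, h]
  push_cast
  rw [mul_pow, mul_div_mul_comm]

theorem sieve_bound (T : ι → ℕ) (hT : ∀ i, 0 < T i) (P : Finset ℕ) (hP : ∀ p ∈ P, p.Prime)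
    (hPT : ∀ p ∈ P, ∀ q ∈ P, ∀ i, p * q ≤ 6 * T i) (Ω : ∀ p : ℕ, Finset (ι → ZMod p))
    {δ : ℝ} (hδ : 0 ≤ δ) (hΩ : ∀ p ∈ P, δ * (p : ℝ) ^ Fintype.card ι ≤ (Ω p).card)
    (S : Finset (ι → ℤ)) (hS : ∀ a ∈ S, (∀ i, |a i| ≤ T i) ∧
      ∀ p ∈ P, (fun i => (a i : ZMod p)) ∉ Ω p) :
    (S.card : ℝ) * (δ ^ 2 * P.card) ≤ 24 ^ Fintype.card ι * ∏ i, (T i : ℝ) := by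
  classical
  rcases P.eq_empty_or_nonempty with rfl | hPne
  · simp only [Finset.card_empty, Nat.cast_zero, mul_zero]
    positivity
  set M : ℕ := (∏ i, 6 * T i) * ∏ p ∈ P, p with hMdef
  have hM0 : M ≠ 0 := mul_ne_zero (Finset.prod_ne_zero_iff.2 fun i _ => by have := hT i; omega)
    (Finset.prod_ne_zero_iff.2 fun p hp => (hP p hp).ne_zero)
  have : NeZero M := ⟨hM0⟩
  have hTM : ∀ i, 6 * T i ∣ M := fun i =>
    (Finset.dvd_prod_of_mem (fun i => 6 * T i) (Finset.mem_univ i)).mul_right _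
  have hpM : ∀ p ∈ P, p ∣ M := fun p hp => (Finset.dvd_prod_of_mem (fun p => p) hp).mul_left _
  choose N' hN' using hTM
  have hN : ∀ i, M = N' i * (6 * T i) := fun i => (hN' i).trans (mul_comm _ _)
  have hN0 : ∀ i, 0 < N' i := fun i => Nat.pos_of_ne_zero fun h => hM0 (by rw [hN i, h, zero_mul])
  have hW : ∀ i, (M : ℝ) / N' i = 6 * T i := by
    intro i
    have : (N' i : ℝ) ≠ 0 := Nat.cast_ne_zero.2 (hN0 i).ne'
    rw [div_eq_iff this]
    exact_mod_cast (hN i).trans (mul_comm _ _)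
  let w : (ι → ZMod M) → ℝ := fun t => ∏ i, fejer M (N' i) (t i)
  have hw0 : ∀ t, 0 ≤ w t := fun t => Finset.prod_nonneg fun i _ => fejer_nonneg _ _ _
  let W : ℝ := ∏ i, ((M : ℝ) / N' i)
  have hWpos : 0 ≤ W := Finset.prod_nonneg fun i _ => by positivity
  let d : ℕ → ℝ := fun p => (Ω p).card / (p : ℝ) ^ Fintype.card ι
  let red : ∀ p : ℕ, (ι → ZMod M) → (ι → ZMod p) := fun p t i => (t i).cast
  let g : ℕ → (ι → ZMod M) → ℝ := fun p t => if red p t ∈ Ω p then 1 else 0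
  have hle : ∀ p ∈ P, ∀ q ∈ P, ∀ i, N' i * (p * q) ≤ M := fun p hp q hq i => by
    rw [hN i]
    exact Nat.mul_le_mul_left _ (hPT p hp q hq i)
  have hle1 : ∀ p ∈ P, ∀ i, N' i * p ≤ M := fun p hp i =>
    (Nat.mul_le_mul_left _ (Nat.le_mul_of_pos_right p (hP p hp).pos)).trans (hle p hp p hp i)
  have E1 : ∀ p ∈ P, ∑ t, w t * g p t = W * d p := by
    intro p hp
    have h := sum_prod_fejer_zmod hN0 (hpM p hp) (hle1 p hp) (Ω p)
    rw [Finset.sum_filter] at h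
    rw [← h]
    refine Finset.sum_congr rfl fun t _ => ?_
    simp only [g, mul_ite, mul_one, mul_zero]
    rfl
  have E0 : ∑ t, w t = W := by
    obtain ⟨p, hp⟩ := hPne
    have : NeZero p := ⟨(hP p hp).ne_zero⟩
    have h := sum_prod_fejer_zmod hN0 (hpM p hp) (hle1 p hp) Finset.univ
    have hp0 : (p : ℝ) ≠ 0 := Nat.cast_ne_zero.2 (hP p hp).ne_zero
    rw [Finset.card_univ, Fintype.card_fun, ZMod.card, Nat.cast_pow,
      div_self (pow_ne_zero _ hp0), mul_one] at h
    simpa only [Finset.mem_univ, Finset.filter_true] using h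
  have E2 : ∀ p ∈ P, ∀ q ∈ P, p ≠ q → ∑ t, w t * (g p t * g q t) = W * (d p * d q) := by
    intro p hp q hq hpq
    have h := sum_prod_fejer_zmod_two hN0 ((Nat.coprime_primes (hP p hp) (hP q hq)).2 hpq)
      (hpM p hp) (hpM q hq) (hle p hp q hq) (Ω p) (Ω q)
    rw [Finset.sum_filter] at h
    rw [← h]
    refine Finset.sum_congr rfl fun t _ => ?_
    rw [mul_comm (g p t)]
    simp only [g, ← ite_and, mul_ite, mul_one, mul_zero]
    rfl
  have Ecov : ∀ p ∈ P, ∀ q ∈ P, ∑ t, w t * ((g p t - d p) * (g q t - d q)) ≤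
      if p = q then W else 0 := by
    intro p hp q hq
    have h1 : ∑ t, w t * ((g p t - d p) * (g q t - d q)) = ∑ t, w t * (g p t * g q t) -
        d q * ∑ t, w t * g p t - d p * ∑ t, w t * g q t + d p * d q * ∑ t, w t := by
      rw [Finset.mul_sum, Finset.mul_sum, Finset.mul_sum, ← Finset.sum_sub_distrib,
        ← Finset.sum_sub_distrib, ← Finset.sum_add_distrib]
      exact Finset.sum_congr rfl fun t _ => by ring
    rw [h1, E1 p hp, E1 q hq, E0]
    split_ifs with hpq
    · subst hpq
      have h2 : ∑ t, w t * (g p t * g p t) = W * d p := by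
        rw [← E1 p hp]
        refine Finset.sum_congr rfl fun t _ => ?_
        simp only [g]
        split_ifs <;> ring
      rw [h2]
      nlinarith [mul_nonneg hWpos (sq_nonneg (d p - 1 / 2))]
    · rw [E2 p hp q hq hpq]
      apply le_of_eq
      ring
  have Evar : ∑ t, w t * (∑ p ∈ P, (g p t - d p)) ^ 2 ≤ W * P.card := by
    have h1 : ∑ t, w t * (∑ p ∈ P, (g p t - d p)) ^ 2 =
        ∑ p ∈ P, ∑ q ∈ P, ∑ t, w t * ((g p t - d p) * (g q t - d q)) := by
      simp_rw [sq, Finset.sum_mul_sum, Finset.mul_sum]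
      rw [Finset.sum_comm]
      refine Finset.sum_congr rfl fun p _ => Finset.sum_comm
    rw [h1]
    refine (Finset.sum_le_sum fun p hp => Finset.sum_le_sum fun q hq => Ecov p hp q hq).trans ?_
    apply le_of_eq
    rw [Finset.sum_congr rfl fun p hp => by rw [Finset.sum_ite_eq, if_pos hp], Finset.sum_const,
      nsmul_eq_mul, mul_comm]
  let r : (ι → ℤ) → (ι → ZMod M) := fun a i => (a i : ZMod M)
  have hinj : Set.InjOn r S := by
    intro a ha b hb hab
    funext i
    have h1 := congrFun hab i
    simp only [r] at h1
    rw [ZMod.intCast_eq_intCast_iff_dvd_sub] at h1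
    have h2 := (hS a ha).1 i
    have h3 := (hS b hb).1 i
    have h4 : ((6 * T i : ℕ) : ℤ) ≤ M := by
      have := hN i
      have h5 := Nat.le_mul_of_pos_left (6 * T i) (hN0 i)
      omega
    have h6 := hT i
    rw [abs_le] at h2 h3
    have h7 := Int.eq_zero_of_abs_lt_dvd h1 (by rw [abs_lt]; omega)
    omega
  have hlow : ∀ a ∈ S, (1 / 4 : ℝ) ^ Fintype.card ι * (δ * P.card) ^ 2 ≤
      w (r a) * (∑ p ∈ P, (g p (r a) - d p)) ^ 2 := by
    intro a ha
    refine mul_le_mul ?_ ?_ (by positivity) (hw0 _)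
    · rw [← Finset.card_univ, ← Finset.prod_const]
      exact Finset.prod_le_prod (fun _ _ => by norm_num)
        fun i _ => one_div_four_le_fejer (hN0 i) (hN i) ((hS a ha).1 i)
    · have h1 : ∀ p ∈ P, g p (r a) - d p = - d p := by
        intro p hp
        have h2 : red p (r a) = fun i => (a i : ZMod p) := by
          funext i
          exact ZMod.cast_intCast (hpM p hp) (a i)
        simp only [g, h2, if_neg ((hS a ha).2 p hp), zero_sub]
      rw [Finset.sum_congr rfl h1, Finset.sum_neg_distrib, neg_sq]
      have h3 : δ * P.card ≤ ∑ p ∈ P, d p := by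
        rw [mul_comm, ← nsmul_eq_mul]
        refine Finset.card_nsmul_le_sum _ _ _ fun p hp => ?_
        rw [le_div_iff₀ (pow_pos (Nat.cast_pos.2 (hP p hp).pos) _)]
        exact hΩ p hp
      gcongr
  have hfin : (S.card : ℝ) * ((1 / 4 : ℝ) ^ Fintype.card ι * (δ * P.card) ^ 2) ≤ W * P.card := by
    refine le_trans ?_ Evar
    rw [← nsmul_eq_mul]
    refine (Finset.card_nsmul_le_sum _ _ _ hlow).trans ?_
    rw [← Finset.sum_image (f := fun t => w t * (∑ p ∈ P, (g p t - d p)) ^ 2) hinj]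
    exact Finset.sum_le_sum_of_subset_of_nonneg (Finset.subset_univ _)
      fun t _ _ => mul_nonneg (hw0 t) (sq_nonneg _)
  have hPpos : (0 : ℝ) < P.card := Nat.cast_pos.2 hPne.card_pos
  have hW' : W = 6 ^ Fintype.card ι * ∏ i, (T i : ℝ) := by
    simp only [W, hW]
    rw [Finset.prod_mul_distrib, Finset.prod_const, Finset.card_univ]
  have h4 : (4 : ℝ) ^ Fintype.card ι * (1 / 4) ^ Fintype.card ι = 1 := by
    rw [← mul_pow]; norm_num
  have h24 : (24 : ℝ) ^ Fintype.card ι = 4 ^ Fintype.card ι * 6 ^ Fintype.card ι := by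
    rw [← mul_pow]; norm_num
  rw [h24, mul_assoc, ← hW']
  refine le_of_mul_le_mul_right ?_ hPpos
  calc (S.card : ℝ) * (δ ^ 2 * P.card) * P.card
      = (4 ^ Fintype.card ι * (1 / 4) ^ Fintype.card ι) * (S.card * (δ * P.card) ^ 2) := by
        rw [h4]; ring
    _ = 4 ^ Fintype.card ι * (S.card * ((1 / 4) ^ Fintype.card ι * (δ * P.card) ^ 2)) := by ring
    _ ≤ 4 ^ Fintype.card ι * (W * P.card) := by gcongr
    _ = _ := by ring
end

theorem exists_cycle_parametrization {α : Type*} [Fintype α] (σ : Equiv.Perm α) :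
    ∃ (κ : Type) (_ : Fintype κ) (rep : κ → α) (l : κ → ℕ),
      (∀ ω, 0 < l ω) ∧ (∀ ω, (σ ^ l ω) (rep ω) = rep ω) ∧
      (∀ i, ∃ ω, ∃ k < l ω, (σ ^ k) (rep ω) = i) ∧
      (∀ ω ω' a b, a < l ω → b < l ω' → (σ ^ a) (rep ω) = (σ ^ b) (rep ω') → ω = ω' ∧ a = b) ∧
      ∑ ω, l ω = Fintype.card α := by
  classical
  let s := Equiv.Perm.SameCycle.setoid σ
  obtain ⟨m, ⟨f⟩⟩ := Finite.exists_equiv_fin (Quotient s)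
  let rep : Fin m → α := fun ω => (f.symm ω).out
  let l : Fin m → ℕ := fun ω => Function.minimalPeriod σ (rep ω)
  have hper : ∀ x, x ∈ Function.periodicPts σ := fun x =>
    ⟨orderOf σ, orderOf_pos σ, by
      rw [Function.IsPeriodicPt, Function.IsFixedPt, ← Equiv.Perm.coe_pow, pow_orderOf_eq_one]; rfl⟩
  have h0 : ∀ ω, 0 < l ω := fun ω => Function.minimalPeriod_pos_of_mem_periodicPts (hper _)
  have h1 : ∀ i, ∃ ω, ∃ k < l ω, (σ ^ k) (rep ω) = i := by
    intro i
    refine ⟨f (Quotient.mk s i), ?_⟩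
    have h2 : rep (f (Quotient.mk s i)) = (Quotient.mk s i).out := by simp [rep]
    have h3 : σ.SameCycle (rep (f (Quotient.mk s i))) i := by
      rw [h2]; exact Quotient.mk_out (s := s) i
    obtain ⟨k, hk⟩ := h3.exists_nat_pow_eq
    refine ⟨k % l _, Nat.mod_lt _ (h0 _), ?_⟩
    rw [Equiv.Perm.coe_pow, Function.iterate_mod_minimalPeriod_eq, ← Equiv.Perm.coe_pow, hk]
  have h2 : ∀ ω ω' a b, a < l ω → b < l ω' → (σ ^ a) (rep ω) = (σ ^ b) (rep ω') →
      ω = ω' ∧ a = b := by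
    intro ω ω' a b ha hb h
    have e : ω = ω' := by
      have h3 : σ.SameCycle (rep ω) (rep ω') := by
        have e1 : σ.SameCycle (rep ω) ((σ ^ a) (rep ω)) := ⟨a, by simp⟩
        have e2 : σ.SameCycle (rep ω') ((σ ^ b) (rep ω')) := ⟨b, by simp⟩
        exact e1.trans (h ▸ e2.symm)
      have h4 : Quotient.mk s (rep ω) = Quotient.mk s (rep ω') := Quotient.sound h3
      simpa [rep] using h4
    subst e
    refine ⟨rfl, ?_⟩
    rw [Equiv.Perm.coe_pow, Equiv.Perm.coe_pow] at h
    exact (Function.iterate_eq_iterate_iff_of_lt_minimalPeriod ha hb).1 h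
  refine ⟨Fin m, inferInstance, rep, l, h0, fun ω => ?_, h1, h2, ?_⟩
  · rw [Equiv.Perm.coe_pow]; exact Function.iterate_minimalPeriod
  · have h3 : Function.Bijective (fun x : Σ ω, Fin (l ω) => (σ ^ (x.2 : ℕ)) (rep x.1)) := by
      refine ⟨?_, fun i => ?_⟩
      · rintro ⟨ω, a⟩ ⟨ω', b⟩ h
        obtain ⟨rfl, h⟩ := h2 _ _ _ _ a.2 b.2 h
        rw [Fin.ext h]
      · obtain ⟨ω, k, hk, h⟩ := h1 i
        exact ⟨⟨ω, k, hk⟩, h⟩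
    rw [← Fintype.card_of_bijective h3, Fintype.card_sigma]
    simp

section
variable {α k : Type*} [Fintype α] [Field k] (p : ℕ) [hp : Fact p.Prime] [CharP k p]

/-- The tuples on which the Frobenius acts through the permutation `σ`. -/
def twistedFrob (k : Type*) [Field k] [CharP k p] (σ : Equiv.Perm α) : AddSubgroup (α → k) where
  carrier := {r | ∀ i, r i ^ p = r (σ i)}
  zero_mem' := fun i => by simp [hp.out.ne_zero]
  add_mem' := fun {a b} ha hb i => by
    have h1 := ha i
    have h2 := hb i
    simp only [Pi.add_apply, add_pow_char, h1, h2]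
  neg_mem' := fun {a} ha i => by
    have h1 := ha i
    rw [Pi.neg_apply, Pi.neg_apply, ← h1]
    exact map_neg (frobenius k p) (a i)

variable {p}

omit [Fintype α] in
theorem pow_pow_of_mem_twistedFrob {σ : Equiv.Perm α} {r : α → k} (hr : r ∈ twistedFrob p k σ)
    (i : α) (a : ℕ) : r i ^ p ^ a = r ((σ ^ a) i) := by
  induction a with
  | zero => simp
  | succ a ih => rw [pow_succ p, pow_mul, ih, pow_succ', Equiv.Perm.mul_apply]; exact hr _

theorem finite_twistedFrob (σ : Equiv.Perm α) : Finite (twistedFrob p k σ) := by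
  classical
  let f : k[X] := X ^ p ^ orderOf σ - X
  have hf : f ≠ 0 := FiniteField.X_pow_card_pow_sub_X_ne_zero k (orderOf_pos σ).ne' hp.out.one_lt
  have : (twistedFrob p k σ : Set (α → k)) ⊆
      (Fintype.piFinset fun _ : α => f.roots.toFinset : Finset (α → k)) := by
    intro r hr
    rw [Finset.mem_coe, Fintype.mem_piFinset]
    intro i
    rw [Multiset.mem_toFinset, mem_roots hf, IsRoot]
    have := pow_pow_of_mem_twistedFrob hr i (orderOf σ)
    rw [pow_orderOf_eq_one] at this
    simp [f, this]
  exact (Set.Finite.subset (Finset.finite_toSet _) this).to_subtype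

variable [IsAlgClosed k]

theorem card_pow_pow_eq_self {l : ℕ} (hl : l ≠ 0) : Nat.card {x : k // x ^ p ^ l = x} = p ^ l := by
  classical
  let f : k[X] := X ^ p ^ l - X
  have hf : f ≠ 0 := FiniteField.X_pow_card_pow_sub_X_ne_zero k hl hp.out.one_lt
  have hsep : f.Separable := galois_poly_separable p _ (dvd_pow_self p hl)
  have h1 : f.roots.toFinset.card = p ^ l := by
    rw [Multiset.toFinset_card_of_nodup (nodup_roots hsep),
      ← (IsAlgClosed.splits f).natDegree_eq_card_roots,
      FiniteField.X_pow_card_pow_sub_X_natDegree_eq k hl hp.out.one_lt]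
  rw [← Fintype.card_coe, ← Nat.card_eq_fintype_card] at h1
  refine (Nat.card_congr (Equiv.subtypeEquivRight fun x => ?_)).trans h1
  rw [Multiset.mem_toFinset, mem_roots hf, IsRoot]
  simp [f, sub_eq_zero]

theorem exists_primitive_pow_pow {l : ℕ} (hl : l ≠ 0) (hp2 : 2 < p) : ∃ x : k, x ≠ 0 ∧
    x ^ p ^ l = x ∧ ∀ a b, a < l → b < l → x ^ p ^ a = x ^ p ^ b → a = b := by
  have hpl : 1 < p ^ l := Nat.one_lt_pow hl hp.out.one_lt
  have : NeZero ((p ^ l - 1 : ℕ) : k) := ⟨by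
    rw [Nat.cast_sub hpl.le, Nat.cast_pow, CharP.cast_eq_zero, zero_pow hl]; simp⟩
  obtain ⟨x, hx⟩ := HasEnoughRootsOfUnity.exists_primitiveRoot k (p ^ l - 1)
  refine ⟨x, hx.ne_zero (by omega), ?_, fun a b ha hb hab => ?_⟩
  · have := hx.pow_eq_one
    rw [← Nat.sub_add_cancel hpl.le, pow_succ, this, one_mul]
  · have hlt : ∀ c, c < l → p ^ c < p ^ l - 1 := by
      intro c hc
      have h1 : p ^ c ≤ p ^ (l - 1) := Nat.pow_le_pow_right (by omega) (by omega)
      have h2 : p ^ l = p ^ (l - 1) * p := by rw [← pow_succ, Nat.sub_add_cancel (by omega)]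
      have h3 : 0 < p ^ (l - 1) := by positivity
      have h4 : p ^ (l - 1) * 3 ≤ p ^ (l - 1) * p := Nat.mul_le_mul_left _ hp2
      omega
    have := hx.pow_inj (hlt a ha) (hlt b hb) hab
    exact Nat.pow_right_injective hp.out.two_le this

omit [Fintype α] [IsAlgClosed k] in
theorem exists_mem_twistedFrob {σ : Equiv.Perm α} {κ : Type*} {rep : κ → α} {l : κ → ℕ}
    (h0 : ∀ ω, 0 < l ω) (hl : ∀ ω, (σ ^ l ω) (rep ω) = rep ω)
    (h1 : ∀ i, ∃ ω, ∃ k < l ω, (σ ^ k) (rep ω) = i)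
    (h2 : ∀ ω ω' a b, a < l ω → b < l ω' → (σ ^ a) (rep ω) = (σ ^ b) (rep ω') → ω = ω' ∧ a = b)
    {x : κ → k} (hx : ∀ ω, x ω ^ p ^ l ω = x ω) :
    ∃ r ∈ twistedFrob p k σ, ∀ ω, ∀ a < l ω, r ((σ ^ a) (rep ω)) = x ω ^ p ^ a := by
  choose w c hc hw using h1
  have key : ∀ ω, ∀ a < l ω, x (w ((σ ^ a) (rep ω))) ^ p ^ c ((σ ^ a) (rep ω)) = x ω ^ p ^ a := by
    intro ω a ha
    obtain ⟨e1, e2⟩ := h2 _ _ _ _ (hc _) ha (hw ((σ ^ a) (rep ω)))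
    rw [e1, e2]
  refine ⟨fun i => x (w i) ^ p ^ c i, fun i => ?_, key⟩
  dsimp only
  rw [← pow_mul, ← pow_succ]
  rcases (Nat.succ_le_of_lt (hc i)).lt_or_eq with h | h
  · rw [← key _ _ h, pow_succ', Equiv.Perm.mul_apply, hw]
  · have h3 := key (w i) 0 (h0 _)
    rw [← Nat.succ_eq_add_one, h, hx]
    have h4 : σ i = rep (w i) := by
      rw [← hl (w i), ← h, Nat.succ_eq_add_one, pow_succ', Equiv.Perm.mul_apply, hw]
    rw [pow_zero, pow_zero, pow_one, Equiv.Perm.one_apply] at h3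
    rw [h4, h3]

theorem pow_card_le_card_twistedFrob (σ : Equiv.Perm α) :
    p ^ Fintype.card α ≤ Nat.card (twistedFrob p k σ) := by
  obtain ⟨κ, _, rep, l, h0, hl, h1, h2, hs⟩ := exists_cycle_parametrization σ
  have := finite_twistedFrob (k := k) (p := p) σ
  have h3 : ∀ x : ∀ ω, {x : k // x ^ p ^ l ω = x}, ∃ r : twistedFrob p k σ,
      ∀ ω, r.1 (rep ω) = x ω := by
    intro x
    obtain ⟨r, hr, h⟩ := exists_mem_twistedFrob h0 hl h1 h2 fun ω => (x ω).2
    refine ⟨⟨r, hr⟩, fun ω => ?_⟩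
    simpa using h ω 0 (h0 ω)
  choose f hf using h3
  have hinj : Function.Injective f := by
    intro x y hxy
    funext ω
    apply Subtype.ext
    rw [← hf x ω, ← hf y ω, hxy]
  have h4 := Nat.card_le_card_of_injective f hinj
  rw [Nat.card_pi, Finset.prod_congr rfl fun ω _ => card_pow_pow_eq_self (h0 ω).ne',
    Finset.prod_pow_eq_pow_sum, hs] at h4
  exact h4

theorem exists_twistedFrob_apply_ne (hp2 : 2 < p) (σ : Equiv.Perm α) {i j : α} (hij : i ≠ j) :
    ∃ r ∈ twistedFrob p k σ, r i ≠ r j := by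
  classical
  obtain ⟨κ, _, rep, l, h0, hl, h1, h2, hs⟩ := exists_cycle_parametrization σ
  obtain ⟨ω, a, ha, rfl⟩ := h1 i
  obtain ⟨ω', b, hb, rfl⟩ := h1 j
  obtain ⟨y, hy0, hyl, hy⟩ := exists_primitive_pow_pow (k := k) (h0 ω).ne' hp2
  obtain ⟨r, hr, h⟩ := exists_mem_twistedFrob (k := k) (p := p) h0 hl h1 h2
    (x := fun v => if v = ω then y else 0) (by
      intro v
      split_ifs with hv
      · rw [hv, hyl]
      · exact zero_pow (pow_ne_zero _ hp.out.ne_zero))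
  refine ⟨r, hr, ?_⟩
  rw [h ω a ha, h ω' b hb, if_pos rfl]
  split_ifs with hv
  · subst hv
    intro hab
    rw [hy a b ha hb hab] at hij
    exact hij rfl
  · rw [zero_pow (pow_ne_zero _ hp.out.ne_zero)]
    exact pow_ne_zero _ hy0

theorem card_twistedFrob_eq_mul_le (hp2 : 2 < p) (σ : Equiv.Perm α) {i j : α} (hij : i ≠ j) :
    Nat.card {r : twistedFrob p k σ // r.1 i = r.1 j} * p ≤ Nat.card (twistedFrob p k σ) := by
  have := finite_twistedFrob (k := k) (p := p) σ
  let f : twistedFrob p k σ →+ k :=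
    ((Pi.evalAddMonoidHom (fun _ => k) i) - (Pi.evalAddMonoidHom (fun _ => k) j)).comp
      (twistedFrob p k σ).subtype
  have hf : ∀ r, f r = r.1 i - r.1 j := fun r => rfl
  have h1 : Nat.card f.ker = Nat.card {r : twistedFrob p k σ // r.1 i = r.1 j} := by
    refine Nat.card_congr (Equiv.subtypeEquivRight fun r => ?_)
    rw [AddMonoidHom.mem_ker, hf, sub_eq_zero]
  obtain ⟨r, hr, hne⟩ := exists_twistedFrob_apply_ne (k := k) hp2 σ hij
  have h2 : p ≤ Nat.card f.range := by
    have h3 : addOrderOf (⟨f ⟨r, hr⟩, ⟨r, hr⟩, rfl⟩ : f.range) = p := by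
      refine addOrderOf_eq_prime ?_ ?_
      · apply Subtype.ext
        simp
      · intro h
        exact hne (sub_eq_zero.1 (congrArg Subtype.val h))
    have : Finite f.range := Finite.of_surjective _ f.rangeRestrict_surjective
    exact h3.ge.trans addOrderOf_le_card
  rw [← h1, ← f.ker.card_mul_index, AddSubgroup.index_ker]
  exact Nat.mul_le_mul_left _ h2
end

section
variable {α k : Type*} [Fintype α] [Field k] {p : ℕ} [hp : Fact p.Prime] [CharP k p] [IsAlgClosed k]

open Classical in
theorem pow_card_le_card_injective (hp2 : 2 < p) (hpn : 2 * Fintype.card α ^ 2 ≤ p)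
    (σ : Equiv.Perm α) :
    p ^ Fintype.card α ≤
      2 * Nat.card {r : twistedFrob p k σ // Function.Injective r.1} := by
  have := finite_twistedFrob (k := k) (p := p) σ
  have := Fintype.ofFinite (twistedFrob p k σ)
  refine (pow_card_le_card_twistedFrob (k := k) σ).trans ?_
  have h1 : ∀ x ∈ (Finset.univ.filter fun x : α × α => x.1 ≠ x.2),
      ((Finset.univ : Finset (twistedFrob p k σ)).filter fun r => r.1 x.1 = r.1 x.2).card * p ≤
        Nat.card (twistedFrob p k σ) := by
    intro x hx
    have h := card_twistedFrob_eq_mul_le (k := k) hp2 σ (Finset.mem_filter.1 hx).2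
    rwa [Nat.card_eq_fintype_card (α := {r : twistedFrob p k σ // r.1 x.1 = r.1 x.2}),
      Fintype.card_subtype] at h
  have h2 : ((Finset.univ : Finset (twistedFrob p k σ)).filter
      fun r => ¬ Function.Injective r.1) ⊆
      (Finset.univ.filter fun x : α × α => x.1 ≠ x.2).biUnion fun x =>
        (Finset.univ : Finset (twistedFrob p k σ)).filter fun r => r.1 x.1 = r.1 x.2 := by
    intro r hr
    obtain ⟨i, j, hij, hne⟩ : ∃ i j, r.1 i = r.1 j ∧ i ≠ j := by
      simpa [Function.Injective] using hr
    simp only [Finset.mem_biUnion, Finset.mem_filter, Finset.mem_univ, true_and]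
    exact ⟨(i, j), hne, hij⟩
  have h3 : (Finset.univ.filter fun x : α × α => x.1 ≠ x.2).card ≤ Fintype.card α ^ 2 := by
    refine (Finset.card_le_univ _).trans ?_
    rw [Fintype.card_prod, sq]
  have h4 : ((Finset.univ : Finset (twistedFrob p k σ)).filter
      fun r => ¬ Function.Injective r.1).card * p ≤
      Fintype.card α ^ 2 * Nat.card (twistedFrob p k σ) :=
    calc _ ≤ (∑ x ∈ (Finset.univ.filter fun x : α × α => x.1 ≠ x.2),
          ((Finset.univ : Finset (twistedFrob p k σ)).filter
            fun r => r.1 x.1 = r.1 x.2).card) * p :=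
          Nat.mul_le_mul_right _ ((Finset.card_le_card h2).trans Finset.card_biUnion_le)
      _ ≤ (Finset.univ.filter fun x : α × α => x.1 ≠ x.2).card *
            Nat.card (twistedFrob p k σ) := by
          rw [Finset.sum_mul, ← smul_eq_mul (Finset.card _)]
          exact Finset.sum_le_card_nsmul _ _ _ h1
      _ ≤ _ := Nat.mul_le_mul_right _ h3
  have h5 := Finset.card_filter_add_card_filter_not
    (s := (Finset.univ : Finset (twistedFrob p k σ)))
    (fun r => Function.Injective r.1)
  rw [Finset.card_univ] at h5
  rw [Nat.card_eq_fintype_card] at h4 ⊢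
  rw [Nat.card_eq_fintype_card,
    Fintype.card_subtype (α := twistedFrob p k σ) (fun r => Function.Injective r.1)]
  set N := ((Finset.univ : Finset (twistedFrob p k σ)).filter
      fun r => ¬ Function.Injective r.1).card
  have h6 : 2 * N * p ≤ Fintype.card (twistedFrob p k σ) * p := by nlinarith
  have h7 := Nat.le_of_mul_le_mul_right h6 hp.out.pos
  omega

theorem pow_pred_card_le_card_injective_sum_zero [Nonempty α] (hp2 : 2 < p)
    (hpn : 2 * Fintype.card α ^ 2 ≤ p) (σ : Equiv.Perm α) :
    p ^ (Fintype.card α - 1) ≤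
      2 * Nat.card {r : twistedFrob p k σ // Function.Injective r.1 ∧ ∑ i, r.1 i = 0} := by
  have := finite_twistedFrob (k := k) (p := p) σ
  have hpos : 0 < Fintype.card α := Fintype.card_pos
  have hn0 : (Fintype.card α : k) ≠ 0 := by
    rw [Ne, CharP.cast_eq_zero_iff k p]
    intro h
    have := Nat.le_of_dvd hpos h
    nlinarith
  have hs : ∀ r : twistedFrob p k σ, (∑ i, r.1 i) ^ p = ∑ i, r.1 i := by
    intro r
    rw [sum_pow_char, ← Equiv.sum_comp σ fun i => r.1 i]
    exact Finset.sum_congr rfl fun i _ => r.2 i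
  have hc : ∀ r : twistedFrob p k σ, ((∑ i, r.1 i) / Fintype.card α) ^ p =
      (∑ i, r.1 i) / Fintype.card α := by
    intro r
    rw [div_pow, hs]
    congr 1
    exact map_natCast (frobenius k p) _
  have hmem : ∀ r : twistedFrob p k σ,
      (fun i => r.1 i - (∑ i, r.1 i) / Fintype.card α) ∈ twistedFrob p k σ := by
    intro r i
    rw [sub_pow_char, hc, r.2 i]
  let f : {r : twistedFrob p k σ // Function.Injective r.1} →
      {r : twistedFrob p k σ // Function.Injective r.1 ∧ ∑ i, r.1 i = 0} ×
        {x : k // x ^ p ^ 1 = x} :=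
    fun r => ⟨⟨⟨_, hmem r.1⟩, fun i j hij => r.2 (by simpa using hij), by
      simp only [Finset.sum_sub_distrib, Finset.sum_const, Finset.card_univ, nsmul_eq_mul]
      rw [mul_div_cancel₀ _ hn0, sub_self]⟩, ⟨∑ i, r.1.1 i, by rw [pow_one]; exact hs r.1⟩⟩
  have hf : Function.Injective f := by
    intro r r' h
    have h1 : ∑ i, r.1.1 i = ∑ i, r'.1.1 i := congrArg (fun x => x.2.1) h
    have h2 : (fun i => r.1.1 i - (∑ i, r.1.1 i) / Fintype.card α) =
      (fun i => r'.1.1 i - (∑ i, r'.1.1 i) / Fintype.card α) := congrArg (fun x => x.1.1.1) h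
    apply Subtype.ext
    apply Subtype.ext
    funext i
    have h3 := congrFun h2 i
    simp only [h1] at h3
    exact sub_left_injective h3
  have hfin : Finite {x : k // x ^ p ^ 1 = x} := Nat.finite_of_card_ne_zero (by
    rw [card_pow_pow_eq_self one_ne_zero]; exact pow_ne_zero _ hp.out.ne_zero)
  have h1 := Nat.card_le_card_of_injective f hf
  rw [Nat.card_prod, card_pow_pow_eq_self one_ne_zero, pow_one] at h1
  have h2 := pow_card_le_card_injective (k := k) hp2 hpn σ
  obtain ⟨m, hm⟩ : ∃ m, Fintype.card α = m + 1 := ⟨_, (Nat.sub_add_cancel hpos).symm⟩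
  rw [hm, pow_succ] at h2
  rw [hm, Nat.add_sub_cancel]
  refine Nat.le_of_mul_le_mul_right (h2.trans ?_) hp.out.pos
  rw [mul_assoc]
  exact Nat.mul_le_mul_left _ h1
end

/-- The monic polynomial of degree `n` whose coefficient of degree `n - 1` vanishes, and whose
other coefficients are given by `a`. -/
noncomputable def polyOf {R : Type*} [Semiring R] (n : ℕ) (a : Fin (n - 1) → R) : R[X] :=
  X ^ n + ∑ j : Fin (n - 1), C (a j) * X ^ (j : ℕ)

theorem map_polyOf {R S : Type*} [Semiring R] [Semiring S] (f : R →+* S) (n : ℕ)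
    (a : Fin (n - 1) → R) : (polyOf n a).map f = polyOf n fun j => f (a j) := by
  simp [polyOf, Polynomial.map_sum]

theorem eq_polyOf {R : Type*} [Semiring R] {n : ℕ} (hn : 0 < n) {P : R[X]} (hP : P.Monic)
    (hdeg : P.natDegree = n) (hc : P.coeff (n - 1) = 0) :
    P = polyOf n fun j => P.coeff j := by
  obtain ⟨m, rfl⟩ : ∃ m, n = m + 1 := ⟨_, (Nat.sub_add_cancel hn).symm⟩
  rw [Nat.add_sub_cancel] at hc
  have h := hP.as_sum
  rw [hdeg, Finset.sum_range_succ, hc, C_0, zero_mul, add_zero, Finset.sum_range] at h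
  exact h

section
variable (p : ℕ) [hp : Fact p.Prime]

open Classical in
/-- The vectors of coefficients of the separable polynomials over `ZMod p` whose roots are
permuted through `σ` by the Frobenius. -/
noncomputable def frobSet {n : ℕ} (σ : Equiv.Perm (Fin n)) : Finset (Fin (n - 1) → ZMod p) :=
  Finset.univ.filter fun a => ∃ r : Fin n → AlgebraicClosure (ZMod p), Function.Injective r ∧
    (∀ i, r i ^ p = r (σ i)) ∧
    (polyOf n a).map (algebraMap (ZMod p) (AlgebraicClosure (ZMod p))) = ∏ i, (X - C (r i))

variable {p}

theorem mem_range_algebraMap_of_pow_eq {k : Type*} [Field k] [Algebra (ZMod p) k] {x : k}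
    (hx : x ^ p = x) : ∃ y : ZMod p, algebraMap (ZMod p) k y = x := by
  have : CharP k p := charP_of_injective_algebraMap (algebraMap (ZMod p) k).injective p
  obtain ⟨m, hm⟩ := (mem_bot_iff_intCast p k).1 ((Subfield.mem_bot_iff_pow_eq_self k p).2 hx)
  exact ⟨m, by rw [map_intCast, hm]⟩

theorem exists_polyOf_eq_prod {k : Type*} [Field k] [Algebra (ZMod p) k] {n : ℕ} (hn : 0 < n)
    {σ : Equiv.Perm (Fin n)} {r : Fin n → k} (hr : ∀ i, r i ^ p = r (σ i)) (hs : ∑ i, r i = 0) :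
    ∃ a : Fin (n - 1) → ZMod p,
      (polyOf n a).map (algebraMap (ZMod p) k) = ∏ i, (X - C (r i)) := by
  have : CharP k p := charP_of_injective_algebraMap (algebraMap (ZMod p) k).injective p
  set P : k[X] := ∏ i, (X - C (r i)) with hP
  have hmon : P.Monic := monic_prod_X_sub_C _ _
  have hdeg : P.natDegree = n := by simp [hP, natDegree_finsetProd_X_sub_C_eq_card]
  have hc : P.coeff (n - 1) = 0 := by
    have := prod_X_sub_C_coeff_card_pred Finset.univ r (by simpa using hn)
    rw [Finset.card_univ, Fintype.card_fin] at this
    rw [hP, this, hs, neg_zero]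
  have hmap : P.map (frobenius k p) = P := by
    rw [hP, Polynomial.map_prod]
    simp only [Polynomial.map_sub, map_X, map_C]
    rw [← Equiv.prod_comp σ (fun i => X - C (r i))]
    exact Finset.prod_congr rfl fun i _ => by rw [frobenius_def, hr]
  have hcoeff : ∀ j : Fin (n - 1), ∃ y : ZMod p, algebraMap (ZMod p) k y = P.coeff j := by
    intro j
    apply mem_range_algebraMap_of_pow_eq
    conv_rhs => rw [← hmap, coeff_map, frobenius_def]
  choose a ha using hcoeff
  refine ⟨a, ?_⟩
  rw [map_polyOf, eq_polyOf hn hmon hdeg hc]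
  simp only [ha]

theorem pow_le_card_frobSet {n : ℕ} (hn : 0 < n) (hp2 : 2 < p) (hpn : 2 * n ^ 2 ≤ p)
    (σ : Equiv.Perm (Fin n)) : p ^ (n - 1) ≤ 2 * (n ^ n * (frobSet p σ).card) := by
  classical
  have : Nonempty (Fin n) := ⟨⟨0, hn⟩⟩
  let k := AlgebraicClosure (ZMod p)
  have := finite_twistedFrob (k := k) (p := p) σ
  have h1 := pow_pred_card_le_card_injective_sum_zero (k := k) (α := Fin n) hp2
    (by rwa [Fintype.card_fin]) σ
  rw [Fintype.card_fin] at h1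
  refine h1.trans (Nat.mul_le_mul_left _ ?_)
  have h2 : ∀ r : {r : twistedFrob p k σ // Function.Injective r.1 ∧ ∑ i, r.1 i = 0},
      ∃ a : frobSet p σ,
        (polyOf n a.1).map (algebraMap (ZMod p) k) = ∏ i, (X - C (r.1.1 i)) := by
    intro r
    obtain ⟨a, ha⟩ := exists_polyOf_eq_prod hn r.1.2 r.2.2
    exact ⟨⟨a, Finset.mem_filter.2 ⟨Finset.mem_univ _, r.1.1, r.2.1, r.1.2, ha⟩⟩, ha⟩
  choose f hf using h2
  have := Fintype.ofFinite {r : twistedFrob p k σ // Function.Injective r.1 ∧ ∑ i, r.1 i = 0}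
  rw [Nat.card_eq_fintype_card, ← Finset.card_univ]
  have h3 := Finset.card_le_mul_card_image_of_maps_to (f := f) (s := Finset.univ)
    (t := Finset.univ) (fun _ _ => Finset.mem_univ _) (n ^ n) (by
      intro a _
      let R : Finset k := ((polyOf n a.1).map (algebraMap (ZMod p) k)).roots.toFinset
      by_cases hne : ∃ r, f r = a
      · obtain ⟨r₀, hr₀⟩ := hne
        have hR : R.card ≤ n := by
          refine (Multiset.toFinset_card_le _).trans ((card_roots' _).trans ?_)
          rw [← hr₀, hf, natDegree_finsetProd_X_sub_C_eq_card, Finset.card_univ, Fintype.card_fin]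
        have : (Finset.univ.filter fun r => f r = a).card ≤
            (Fintype.piFinset fun _ : Fin n => R).card := by
          refine Finset.card_le_card_of_injOn (fun r => r.1.1) ?_ ?_
          · intro r hr
            have hr' : f r = a := (Finset.mem_filter.1 hr).2
            rw [Finset.mem_coe, Fintype.mem_piFinset]
            intro i
            rw [Multiset.mem_toFinset, ← hr', hf,
              mem_roots (monic_prod_X_sub_C _ _).ne_zero, IsRoot, eval_prod]
            exact Finset.prod_eq_zero (Finset.mem_univ i) (by simp)
          · intro r _ r' _ h
            exact Subtype.ext (Subtype.ext h)
        refine this.trans ?_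
        rw [Fintype.card_piFinset_const]
        exact Nat.pow_le_pow_left hR n
      · have : (Finset.univ.filter fun r => f r = a) = ∅ :=
          Finset.filter_eq_empty_iff.2 fun r _ h => hne ⟨r, h⟩
        rw [this, Finset.card_empty]
        exact Nat.zero_le _)
  rwa [Finset.card_univ (α := frobSet p σ), Fintype.card_coe] at h3
end

/-- Jordan's theorem: a proper subgroup of a finite group misses some conjugacy class. -/
theorem Subgroup.exists_forall_conj_notMem {Γ : Type*} [Group Γ] [Finite Γ] {H : Subgroup Γ}
    (hH : H ≠ ⊤) : ∃ σ : Γ, ∀ τ : Γ, τ⁻¹ * σ * τ ∉ H := by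
  classical
  have := Fintype.ofFinite Γ
  by_contra! hcon
  have h := MulAction.sum_card_fixedBy_eq_card_orbits_mul_card_group Γ (Γ ⧸ H)
  have h1 : Fintype.card (MulAction.orbitRel.Quotient Γ (Γ ⧸ H)) = 1 := by
    rw [Fintype.card_eq_one_iff_nonempty_unique]
    have := (MulAction.pretransitive_iff_unique_quotient_of_nonempty Γ (Γ ⧸ H)).1 inferInstance
    exact this
  rw [h1, one_mul] at h
  have h2 : ∀ σ : Γ, 1 ≤ Fintype.card (MulAction.fixedBy (Γ ⧸ H) σ) := by
    intro σ
    obtain ⟨τ, hτ⟩ := hcon σ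
    rw [Nat.one_le_iff_ne_zero, Ne, Fintype.card_eq_zero_iff, not_isEmpty_iff]
    refine ⟨⟨(τ : Γ ⧸ H), ?_⟩⟩
    rw [MulAction.mem_fixedBy, MulAction.Quotient.smul_coe, smul_eq_mul, eq_comm,
      QuotientGroup.eq, ← mul_assoc]
    exact hτ
  have h3 : 1 < Fintype.card (MulAction.fixedBy (Γ ⧸ H) (1 : Γ)) := by
    obtain ⟨x, hx⟩ : ∃ x, x ∉ H := by
      by_contra! h
      exact hH ((Subgroup.eq_top_iff' H).2 h)
    rw [Fintype.one_lt_card_iff]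
    refine ⟨⟨((1 : Γ) : Γ ⧸ H), by simp⟩, ⟨(x : Γ ⧸ H), by simp⟩, fun e => hx ?_⟩
    have := QuotientGroup.eq.1 (congrArg Subtype.val e)
    simpa using this
  have h4 : ∑ _σ : Γ, 1 < ∑ σ : Γ, Fintype.card (MulAction.fixedBy (Γ ⧸ H) σ) :=
    Finset.sum_lt_sum (fun σ _ => h2 σ) ⟨1, Finset.mem_univ _, h3⟩
  rw [h, Finset.sum_const, Finset.card_univ, smul_eq_mul, mul_one] at h4
  exact lt_irrefl _ h4

theorem exists_reduction_frobenius (L : Type*) [Field L] [NumberField L] [IsGalois ℚ L] (p : ℕ)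
    [hp : Fact p.Prime] : ∃ (θ : 𝓞 L →+* AlgebraicClosure (ZMod p)) (g : L ≃ₐ[ℚ] L),
      ∀ x : 𝓞 L, θ (g • x) = θ x ^ p := by
  have hpm : (Ideal.span {(p : ℤ)}).IsMaximal :=
    ((Ideal.span_singleton_prime (by exact_mod_cast hp.out.ne_zero)).2
      (Nat.prime_iff_prime_int.1 hp.out)).isMaximal (by
        simpa using hp.out.ne_zero)
  obtain ⟨⟨Q, hQp, hQ⟩⟩ :=
    (inferInstance : Nonempty (Ideal.primesOver (Ideal.span {(p : ℤ)}) (𝓞 L)))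
  have hmem : (p : 𝓞 L) ∈ Q := by
    have h1 : (p : ℤ) ∈ Q.under ℤ := by
      rw [← hQ.over]; exact Ideal.mem_span_singleton_self _
    simpa [Ideal.mem_comap] using h1
  have hQ0 : Q ≠ ⊥ := by
    rintro rfl
    rw [Ideal.mem_bot] at hmem
    exact hp.out.ne_zero (by exact_mod_cast hmem)
  have : Finite (𝓞 L ⧸ Q) := Ideal.finiteQuotientOfFreeOfNeBot Q hQ0
  have : Q.IsMaximal := hQp.isMaximal hQ0
  let _ : Field (𝓞 L ⧸ Q) := Ideal.Quotient.field Q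
  have hchar : CharP (𝓞 L ⧸ Q) p := by
    have h0 : ((p : ℕ) : 𝓞 L ⧸ Q) = 0 := by
      have := Ideal.Quotient.eq_zero_iff_mem.2 hmem
      rwa [map_natCast] at this
    obtain ⟨q, hq⟩ := CharP.exists (𝓞 L ⧸ Q)
    have h1 := (CharP.cast_eq_zero_iff (𝓞 L ⧸ Q) q p).1 h0
    rcases (Nat.dvd_prime hp.out).1 h1 with h | h
    · subst h
      exact absurd rfl (CharP.char_ne_one (𝓞 L ⧸ Q) 1)
    · rwa [← h]
  let _ : Algebra (ZMod p) (𝓞 L ⧸ Q) := ZMod.algebra _ p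
  have : Algebra.IsAlgebraic (ZMod p) (𝓞 L ⧸ Q) := Algebra.IsAlgebraic.of_finite _ _
  let ψ : (𝓞 L ⧸ Q) →ₐ[ZMod p] AlgebraicClosure (ZMod p) := IsAlgClosed.lift
  obtain ⟨g, hg⟩ := IsArithFrobAt.exists_of_isInvariant ℤ (L ≃ₐ[ℚ] L) Q
  refine ⟨ψ.toRingHom.comp (Ideal.Quotient.mk Q), g, fun x => ?_⟩
  have hcard : Nat.card (ℤ ⧸ Q.under ℤ) = p := by
    rw [← hQ.over, Nat.card_congr (Int.quotientSpanNatEquivZMod p).toEquiv, Nat.card_zmod]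
  have h1 := hg.mk_apply x
  rw [hcard] at h1
  have h2 := congrArg ψ h1
  rw [map_pow] at h2
  exact h2

instance normal_Qbar : Normal ℚ Qbar where
  splits' _ := IsAlgClosed.splits _

theorem notMem_frobSet {n : ℕ} {K : IntermediateField ℚ Qbar} [FiniteDimensional ℚ K]
    {G : Subgroup (Equiv.Perm (Fin n))} (hG : HasGalGroup n K G) {β : K}
    (hgen : ∀ φ ψ : K →ₐ[ℚ] Qbar, φ β = ψ β → φ = ψ) {a : Fin (n - 1) → ℤ}
    (ha : aeval β (polyOf n a) = 0) (hdeg : (polyOf n a).natDegree = n)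
    (hmon : (polyOf n a).Monic)
    {σ : Equiv.Perm (Fin n)} (hσ : ∀ τ : Equiv.Perm (Fin n), τ⁻¹ * σ * τ ∉ G) (p : ℕ)
    [hp : Fact p.Prime] : (fun i => (a i : ZMod p)) ∉ frobSet p σ := by
  obtain ⟨e, he⟩ := hG
  intro hmem
  classical
  obtain ⟨r, hr, hrσ, hprod⟩ := (Finset.mem_filter.1 hmem).2
  let L : IntermediateField ℚ Qbar := IntermediateField.normalClosure ℚ K Qbar
  have : NumberField L := ⟨⟩
  have : Normal ℚ L := normalClosure.normal ℚ K Qbar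
  have : IsGalois ℚ L := ⟨⟩
  obtain ⟨θ, g, hg⟩ := exists_reduction_frobenius L p
  let α : Fin n → Qbar := fun i => e.symm i β
  have hα : Function.Injective α := fun i j h => e.symm.injective (hgen _ _ h)
  have hαL : ∀ i, α i ∈ L := fun i => (e.symm i).fieldRange_le_normalClosure ⟨β, rfl⟩
  have hroot : ∀ i, aeval (α i) (polyOf n a) = 0 := by
    intro i
    have := aeval_algHom_apply ((e.symm i).restrictScalars ℤ) β (polyOf n a)
    rw [ha, map_zero] at this
    exact this
  have h_integral : ∀ i, IsIntegral ℤ (⟨α i, hαL i⟩ : L) := by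
    intro i
    refine ⟨polyOf n a, hmon, ?_⟩
    apply L.val.injective
    rw [map_zero, ← aeval_def]
    have := aeval_algHom_apply (L.val.restrictScalars ℤ) ⟨α i, hαL i⟩ (polyOf n a)
    exact this.symm.trans (hroot i)
  let x : Fin n → 𝓞 L := fun i => ⟨⟨α i, hαL i⟩, h_integral i⟩
  have hinj : Function.Injective (algebraMap (𝓞 L) L) := RingOfIntegers.coe_injective
  let ι : 𝓞 L →+* Qbar := (algebraMap L Qbar).comp (algebraMap (𝓞 L) L)
  have hι : Function.Injective ι := (algebraMap L Qbar).injective.comp hinj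
  have hιx : ∀ i, ι (x i) = α i := fun i => rfl
  have hfac : (polyOf n a).map (Int.castRingHom (𝓞 L)) = ∏ i, (X - C (x i)) := by
    apply map_injective ι hι
    rw [Polynomial.map_map, Polynomial.map_prod]
    simp only [Polynomial.map_sub, map_X, map_C, hιx]
    symm
    have h1 : ((polyOf n a).map (ι.comp (Int.castRingHom (𝓞 L)))).Monic := hmon.map _
    have h2 : (Finset.univ.val.map α) =
        ((polyOf n a).map (ι.comp (Int.castRingHom (𝓞 L)))).roots := by
      refine Multiset.eq_of_le_of_card_le ?_ ?_
      · rw [Multiset.le_iff_subset (Finset.univ.nodup.map hα)]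
        intro y hy
        obtain ⟨i, -, rfl⟩ := Multiset.mem_map.1 hy
        rw [mem_roots h1.ne_zero, IsRoot, eval_map]
        exact (eval₂_congr (RingHom.ext_int _ _) rfl rfl).trans (hroot i)
      · refine (card_roots' _).trans ?_
        rw [hmon.natDegree_map, hdeg]
        simp
    have h3 := (IsAlgClosed.splits
      ((polyOf n a).map (ι.comp (Int.castRingHom (𝓞 L))))).eq_prod_roots_of_monic h1
    rw [← h2, Multiset.map_map] at h3
    exact h3.symm
  have hfac' : ∏ i, (X - C (θ (x i))) = ∏ i, (X - C (r i)) := by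
    rw [← hprod, map_polyOf]
    have := congrArg (Polynomial.map θ) hfac
    rw [Polynomial.map_map, map_polyOf, Polynomial.map_prod] at this
    simp only [Polynomial.map_sub, map_X, map_C] at this
    rw [← this]
    simp
  have hroots := congrArg roots hfac'
  rw [Finset.prod_eq_multiset_prod, Finset.prod_eq_multiset_prod] at hroots
  have hms : Finset.univ.val.map (fun i => θ (x i)) = Finset.univ.val.map r := by
    have h1 := roots_multiset_prod_X_sub_C (Finset.univ.val.map (fun i => θ (x i)))
    have h2 := roots_multiset_prod_X_sub_C (Finset.univ.val.map r)
    rw [Multiset.map_map] at h1 h2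
    exact h1.symm.trans (hroots.trans h2)
  have ht : ∀ i, ∃ j, r j = θ (x i) := by
    intro i
    have : θ (x i) ∈ Finset.univ.val.map r := by
      rw [← hms]; exact Multiset.mem_map.2 ⟨i, Finset.mem_univ_val i, rfl⟩
    obtain ⟨j, -, hj⟩ := Multiset.mem_map.1 this
    exact ⟨j, hj⟩
  choose t ht using ht
  have hθinj : Function.Injective fun i => θ (x i) := by
    have h1 : (Finset.univ.val.map (fun i => θ (x i))).Nodup := by
      rw [hms]; exact Finset.univ.nodup.map hr
    intro i j h
    exact Multiset.inj_on_of_nodup_map h1 _ (Finset.mem_univ_val i) _ (Finset.mem_univ_val j) h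
  have htinj : Function.Injective t := fun i j h => hθinj (by
    show θ (x i) = θ (x j)
    rw [← ht, ← ht, h])
  let τ : Equiv.Perm (Fin n) := Equiv.ofBijective t (Finite.injective_iff_bijective.1 htinj)
  let g' : Qbar ≃ₐ[ℚ] Qbar := g.liftNormal Qbar
  let π : Equiv.Perm (Fin n) := Equiv.permCongr e (galAct K g')
  have hπG : π ∈ G := (he π).2 ⟨g', rfl⟩
  have hπ : ∀ i, x (π i) = g • x i := by
    intro i
    apply hι
    have h1 : ι (x (π i)) = g' (α i) := by
      rw [hιx]
      show e.symm (π i) β = _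
      simp [π, galAct, α]
    rw [h1]
    have h2 := AlgEquiv.liftNormal_commutes g Qbar ⟨α i, hαL i⟩
    exact h2
  refine hσ τ ?_
  convert hπG
  ext1 i
  rw [Equiv.Perm.mul_apply, Equiv.Perm.mul_apply, Equiv.Perm.inv_eq_iff_eq]
  apply hr
  show r (σ (t i)) = r (t (π i))
  rw [← hrσ, ht, ht, hπ, hg]

theorem exists_rpow_le_card_primes (N : ℕ) {ε : ℝ} (hε : 0 < ε) : ∃ C : ℝ, 0 < C ∧
    ∀ Y : ℝ, 1 ≤ Y →
      Y ^ (1 - ε) ≤ C * (1 + ((Nat.primesLE ⌊Y⌋₊).filter fun p => N < p).card) := by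
  refine ⟨(8 + 4 / ε) * (N + 1), by positivity, fun Y hY => ?_⟩
  have hY0 : 0 < Y := by linarith
  set π : ℝ := ((Nat.primesLE ⌊Y⌋₊).card : ℝ) with hπ
  have hcard : π ≤ N + (((Nat.primesLE ⌊Y⌋₊).filter fun p => N < p).card : ℝ) := by
    have h1 := Finset.card_filter_add_card_filter_not (s := Nat.primesLE ⌊Y⌋₊) (fun p => N < p)
    have h2 : ((Nat.primesLE ⌊Y⌋₊).filter fun p => ¬ N < p) ⊆ Finset.Icc 1 N := by
      intro p hp
      rw [Finset.mem_filter, Nat.mem_primesLE] at hp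
      exact Finset.mem_Icc.2 ⟨hp.1.2.one_le, not_lt.1 hp.2⟩
    have h3 := Finset.card_le_card h2
    rw [Nat.card_Icc] at h3
    rw [hπ]
    exact_mod_cast (by omega : (Nat.primesLE ⌊Y⌋₊).card ≤
      N + ((Nat.primesLE ⌊Y⌋₊).filter fun p => N < p).card)
  have hYε : 1 ≤ Y ^ ε := Real.one_le_rpow hY hε.le
  have h1 : Y ≤ (8 + 4 / ε) * Y ^ ε * (1 + π) := by
    have h2 : (Y - 1) * Real.log 2 - Real.log (Y + 2) ≤ π * (Y ^ ε / ε) := by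
      have h3 : (Y - 1) * Real.log 2 - Real.log (Y + 2) ≤ π * Real.log Y := by
        have := (Chebyshev.psi_ge' hY0.le).trans (Chebyshev.psi_le_primeCounting_mul_log' Y)
        rwa [← Nat.primesLE_card_eq_primeCounting] at this
      refine h3.trans (mul_le_mul_of_nonneg_left (Real.log_le_rpow_div hY0.le hε) (by positivity))
    have h4 : Real.log (Y + 2) ≤ (Y + 2) / 4 - 1 + 2 * Real.log 2 := by
      have h5 := Real.log_le_sub_one_of_pos (show 0 < (Y + 2) / 4 by linarith)
      rw [Real.log_div (by linarith) (by norm_num), show (4 : ℝ) = 2 ^ 2 by norm_num,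
        Real.log_pow] at h5
      push_cast at h5
      linarith
    have h6 := Real.log_two_gt_d9
    have h7 := Real.log_two_lt_d9
    have h8 : 0 ≤ π := by positivity
    have h9 : Y ≤ 8 + 4 * (π * (Y ^ ε / ε)) := by nlinarith
    refine h9.trans ?_
    have h10 : 4 * (π * (Y ^ ε / ε)) = 4 / ε * Y ^ ε * π := by ring
    have h11 : 0 ≤ 4 / ε * Y ^ ε := by positivity
    have h12 : 0 ≤ Y ^ ε * π := by positivity
    rw [h10]
    nlinarith
  rw [Real.rpow_sub hY0, Real.rpow_one, div_le_iff₀ (by linarith)]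
  have h2 : 1 + π ≤ (N + 1) * (1 + (((Nat.primesLE ⌊Y⌋₊).filter fun p => N < p).card : ℝ)) := by
    have : (0 : ℝ) ≤ N * (((Nat.primesLE ⌊Y⌋₊).filter fun p => N < p).card : ℝ) := by positivity
    linarith
  calc Y ≤ (8 + 4 / ε) * Y ^ ε * (1 + π) := h1
    _ ≤ (8 + 4 / ε) * Y ^ ε *
        ((N + 1) * (1 + (((Nat.primesLE ⌊Y⌋₊).filter fun p => N < p).card : ℝ))) := by gcongr
    _ = _ := by ring

/-- The coefficient vectors with `|a j| ≤ Y ^ (n - j)` whose reductions avoid `frobSet p σ` for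
every prime `p`. -/
def sievedCoeffs (n : ℕ) (σ : Equiv.Perm (Fin n)) (Y : ℝ) : Set (Fin (n - 1) → ℤ) :=
  {a | (∀ j, |(a j : ℝ)| ≤ Y ^ (n - (j : ℕ))) ∧
    ∀ (p : ℕ) (hp : Fact p.Prime), (fun i => (a i : ZMod p)) ∉ @frobSet p hp n σ}

theorem exists_bound_sievedCoeffs {n : ℕ} (hn : 2 ≤ n) (σ : Equiv.Perm (Fin n)) {ε : ℝ}
    (hε : 0 < ε) : ∃ C : ℝ, 0 ≤ C ∧ ∀ Y : ℝ, 1 ≤ Y → (sievedCoeffs n σ Y).Finite ∧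
      ((sievedCoeffs n σ Y).ncard : ℝ) ≤ C * Y ^ (((n : ℝ) + 2) * (n - 1) / 2 - 1 + ε) := by
  classical
  obtain ⟨C, hC0, hC⟩ := exists_rpow_le_card_primes (2 * n ^ 2) hε
  have hn0 : (0 : ℝ) < n := by exact_mod_cast (by omega : 0 < n)
  let δ : ℝ := 1 / (2 * (n : ℝ) ^ n)
  have hδ0 : 0 < δ := by positivity
  have hδ1 : δ ≤ 1 := by
    have : (1 : ℝ) ≤ (n : ℝ) ^ n := one_le_pow₀ (by exact_mod_cast (by omega : 1 ≤ n))
    exact (div_le_one (by positivity)).2 (by linarith)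
  refine ⟨C / δ ^ 2 * (2 * 24 ^ (n - 1) * 2 ^ (n - 1)), by positivity, fun Y hY => ?_⟩
  have hY0 : 0 < Y := by linarith
  let T : Fin (n - 1) → ℕ := fun j => ⌈Y ^ (n - (j : ℕ))⌉₊
  have hT1 : ∀ j : Fin (n - 1), Y ^ (n - (j : ℕ)) ≤ T j := fun j => Nat.le_ceil _
  have hT2 : ∀ j : Fin (n - 1), (T j : ℝ) ≤ 2 * Y ^ (n - (j : ℕ)) := fun j => by
    have h1 : (1 : ℝ) ≤ Y ^ (n - (j : ℕ)) := one_le_pow₀ hY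
    have h2 := (Nat.ceil_lt_add_one (a := Y ^ (n - (j : ℕ))) (by positivity)).le
    show (⌈Y ^ (n - (j : ℕ))⌉₊ : ℝ) ≤ _
    linarith
  have hT0 : ∀ j, 0 < T j := fun j => Nat.ceil_pos.2 (by positivity)
  let Ω : ∀ p : ℕ, Finset (Fin (n - 1) → ZMod p) := fun p =>
    if h : p.Prime then @frobSet p ⟨h⟩ n σ else ∅
  let P := (Nat.primesLE ⌊Y⌋₊).filter fun p => 2 * n ^ 2 < p
  have hP : ∀ p ∈ P, p.Prime ∧ (p : ℝ) ≤ Y ∧ 2 * n ^ 2 < p := by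
    intro p hp
    rw [Finset.mem_filter, Nat.mem_primesLE] at hp
    exact ⟨hp.1.2, (Nat.le_floor_iff hY0.le).1 hp.1.1, hp.2⟩
  let Q : Finset (Fin (n - 1) → ℤ) := Fintype.piFinset fun j => Finset.Icc (-(T j : ℤ)) (T j)
  have hA : sievedCoeffs n σ Y ⊆ Q := by
    intro a ha
    rw [Finset.mem_coe, Fintype.mem_piFinset]
    intro j
    have : |a j| ≤ T j := by exact_mod_cast (ha.1 j).trans (hT1 j)
    exact Finset.mem_Icc.2 (abs_le.1 this)
  have hfin : (sievedCoeffs n σ Y).Finite := Q.finite_toSet.subset hA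
  refine ⟨hfin, ?_⟩
  rw [Set.ncard_eq_toFinset_card _ hfin]
  set A := hfin.toFinset with hAdef
  have hAQ : A ⊆ Q := fun a ha => hA (hfin.mem_toFinset.1 ha)
  have hprod0 : (0 : ℝ) ≤ ∏ j, (T j : ℝ) := by positivity
  have h1 : (A.card : ℝ) ≤ 24 ^ (n - 1) * ∏ j, (T j : ℝ) := by
    have e1 : (A.card : ℝ) ≤ ∏ j, ((2 * T j + 1 : ℕ) : ℝ) := by
      have := Finset.card_le_card hAQ
      rw [Fintype.card_piFinset] at this
      have e2 : ∀ j, (Finset.Icc (-(T j : ℤ)) (T j)).card = 2 * T j + 1 := by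
        intro j; rw [Int.card_Icc]; omega
      simp only [e2] at this
      exact_mod_cast this
    refine e1.trans ?_
    have e3 : ∏ j, ((2 * T j + 1 : ℕ) : ℝ) ≤ ∏ j, (24 * (T j : ℝ)) := by
      refine Finset.prod_le_prod (fun _ _ => by positivity) fun j _ => ?_
      have : (1 : ℝ) ≤ T j := by exact_mod_cast hT0 j
      push_cast
      linarith
    refine e3.trans (le_of_eq ?_)
    rw [Finset.prod_mul_distrib, Finset.prod_const, Finset.card_univ, Fintype.card_fin]
  have h2 : (A.card : ℝ) * (δ ^ 2 * P.card) ≤ 24 ^ (n - 1) * ∏ j, (T j : ℝ) := by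
    have := sieve_bound T hT0 P (fun p hp => (hP p hp).1) (by
      intro p hp q hq j
      have e1 : Y ^ 2 ≤ Y ^ (n - (j : ℕ)) := pow_le_pow_right₀ hY (by have := j.2; omega)
      have e2 : (p : ℝ) * q ≤ T j := by
        calc (p : ℝ) * q ≤ Y * Y := mul_le_mul (hP p hp).2.1 (hP q hq).2.1 (by positivity) hY0.le
          _ = Y ^ 2 := (sq Y).symm
          _ ≤ T j := e1.trans (hT1 j)
      have e3 : p * q ≤ T j := by exact_mod_cast e2
      omega) Ω hδ0.le (by
      intro p hp
      have hpp := (hP p hp).1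
      have : Fact p.Prime := ⟨hpp⟩
      have hΩ : Ω p = frobSet p σ := dif_pos hpp
      have hp2 := (hP p hp).2.2
      have e1 := pow_le_card_frobSet (p := p) (by omega : 0 < n) (by nlinarith) hp2.le σ
      have e2 : (p : ℝ) ^ (n - 1) ≤ 2 * ((n : ℝ) ^ n * (frobSet p σ).card) := by exact_mod_cast e1
      rw [hΩ, Fintype.card_fin, one_div_mul_eq_div, div_le_iff₀ (by positivity)]
      linarith) A (by
      intro a ha
      have ha' := hfin.mem_toFinset.1 ha
      refine ⟨fun j => by exact_mod_cast (ha'.1 j).trans (hT1 j), fun p hp => ?_⟩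
      have hpp := (hP p hp).1
      have hΩ : Ω p = @frobSet p ⟨hpp⟩ n σ := dif_pos hpp
      rw [hΩ]
      exact ha'.2 p ⟨hpp⟩)
    rwa [Fintype.card_fin] at this
  have h3 : ∏ j, (T j : ℝ) ≤ 2 ^ (n - 1) * Y ^ (((n : ℝ) + 2) * (n - 1) / 2) := by
    calc ∏ j, (T j : ℝ) ≤ ∏ j : Fin (n - 1), (2 * Y ^ (n - (j : ℕ))) :=
          Finset.prod_le_prod (fun _ _ => by positivity) fun j _ => hT2 j
      _ = 2 ^ (n - 1) * Y ^ (∑ i ∈ Finset.range (n - 1), (n - i)) := by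
          rw [Finset.prod_mul_distrib, Finset.prod_const, Finset.card_univ, Fintype.card_fin,
            Finset.prod_pow_eq_pow_sum, Finset.sum_range]
      _ = _ := by
          rw [← sum_range_sub_eq (by omega : 1 ≤ n), Real.rpow_natCast]
  have hYε : 0 < Y ^ (1 - ε) := by positivity
  have h4 : (A.card : ℝ) * (δ ^ 2 * (1 + P.card)) ≤ 2 * 24 ^ (n - 1) * ∏ j, (T j : ℝ) := by
    have : (A.card : ℝ) * δ ^ 2 ≤ A.card := mul_le_of_le_one_right (by positivity)
      (pow_le_one₀ hδ0.le hδ1)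
    linarith
  have h5 : (A.card : ℝ) * Y ^ (1 - ε) ≤
      C / δ ^ 2 * (2 * 24 ^ (n - 1) * 2 ^ (n - 1)) * Y ^ (((n : ℝ) + 2) * (n - 1) / 2) := by
    calc (A.card : ℝ) * Y ^ (1 - ε) ≤ A.card * (C * (1 + P.card)) := by
          gcongr; exact hC Y hY
      _ = C / δ ^ 2 * (A.card * (δ ^ 2 * (1 + P.card))) := by field_simp
      _ ≤ C / δ ^ 2 * (2 * 24 ^ (n - 1) * (2 ^ (n - 1) * Y ^ (((n : ℝ) + 2) * (n - 1) / 2))) :=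
          mul_le_mul_of_nonneg_left
            (h4.trans (mul_le_mul_of_nonneg_left h3 (by positivity))) (by positivity)
      _ = _ := by ring
  rw [← le_div_iff₀ hYε] at h5
  refine h5.trans (le_of_eq ?_)
  rw [mul_div_assoc, ← Real.rpow_sub hY0]
  congr 2
  ring

instance isFractionRing_bot : IsFractionRing ℤ (⊥ : IntermediateField ℚ Qbar) :=
  IsLocalization.isLocalization_of_algEquiv (nonZeroDivisors ℤ)
    ((IntermediateField.botEquiv ℚ Qbar).symm.restrictScalars ℤ)

theorem natDegree_polyOf_le {R : Type*} [Semiring R] (n : ℕ) (a : Fin (n - 1) → R) :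
    (polyOf n a).natDegree ≤ n := by
  refine natDegree_add_le_of_degree_le (natDegree_X_pow_le n) ?_
  refine natDegree_sum_le_of_forall_le _ _ fun j _ => ?_
  exact (natDegree_C_mul_X_pow_le _ _).trans (by have := j.2; omega)

theorem exists_minpoly_eq_polyOf {n : ℕ} (hn : 0 < n) {B : ℝ} (hB : 1 ≤ B) {β : Qbar}
    (hβ : β ∈ elemSet (⊥ : IntermediateField ℚ Qbar) n B) :
    ∃ a : Fin (n - 1) → ℤ, minpoly ℤ β = polyOf n a ∧ (polyOf n a).natDegree = n ∧
      ∀ j, |(a j : ℝ)| ≤ (2 ^ n * B) ^ (n - (j : ℕ)) := by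
  have : NumberField (⊥ : IntermediateField ℚ Qbar) := ⟨⟩
  have hmem := minpoly_mem_polySet (⊥ : IntermediateField ℚ Qbar) hB hβ
  have hmap : minpoly (⊥ : IntermediateField ℚ Qbar) β =
      (minpoly ℤ β).map (algebraMap ℤ (⊥ : IntermediateField ℚ Qbar)) :=
    minpoly.isIntegrallyClosed_eq_field_fractions' _ hβ.1
  rw [hmap] at hmem
  have hmon := minpoly.monic hβ.1
  have hdeg : (minpoly ℤ β).natDegree = n := by
    rw [← hmem.2.1, hmon.natDegree_map]
  have hinj : Function.Injective (algebraMap ℤ (⊥ : IntermediateField ℚ Qbar)) :=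
    IsFractionRing.injective _ _
  have hnext : (minpoly ℤ β).coeff (n - 1) = 0 := by
    have h1 := hmem.2.2.1
    rw [nextCoeff_map hinj, nextCoeff_of_natDegree_pos (by omega), hdeg] at h1
    exact (map_eq_zero_iff _ hinj).1 h1
  have h := eq_polyOf hn hmon hdeg hnext
  refine ⟨_, h, by rw [← h, hdeg], fun j => ?_⟩
  obtain ⟨τ⟩ := (inferInstance : Nonempty ((⊥ : IntermediateField ℚ Qbar) →+* ℂ))
  have h2 := (hmem.2.2.2 j (by have := j.2; omega)).2 τ
  rw [coeff_map, eq_intCast, map_intCast, Complex.norm_intCast] at h2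
  exact h2

theorem adjoinElem_bot_algHom_ext {β : Qbar} (φ ψ : adjoinElem ⊥ β →ₐ[ℚ] Qbar)
    (h : φ ⟨β, mem_adjoinElem ⊥ β⟩ = ψ ⟨β, mem_adjoinElem ⊥ β⟩) : φ = ψ := by
  have hK : adjoinElem ⊥ β = IntermediateField.adjoin ℚ {β} :=
    le_antisymm (adjoinElem_le bot_le (IntermediateField.mem_adjoin_simple_self ℚ β))
      (IntermediateField.adjoin_simple_le_iff.2 (mem_adjoinElem ⊥ β))
  refine IntermediateField.algHom_ext_of_eq_adjoin _ hK ?_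
  rintro x hx
  obtain rfl := Set.mem_singleton_iff.1 hx
  exact h

/-- The fields counted by `FnG n X G`. -/
def galFields (n : ℕ) (G : Subgroup (Equiv.Perm (Fin n))) (X : ℝ) :
    Set (IntermediateField ℚ Qbar) :=
  {K | Module.finrank ℚ K = n ∧ |(fieldDiscr K : ℝ)| ≤ X ∧ HasGalGroup n K G}

theorem exists_bound_galFields_generic {n : ℕ} (hn : 2 ≤ n) {G : Subgroup (Equiv.Perm (Fin n))}
    (hG : G ≠ ⊤) {ε : ℝ} (hε : 0 < ε) : ∃ C : ℝ, 0 ≤ C ∧ ∀ X : ℝ, 1 ≤ X →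
      ((⋃ β ∈ elemSet (⊥ : IntermediateField ℚ Qbar) n (genBound n 1 X),
        fieldsOver (adjoinElem ⊥ β) n X) ∩ galFields n G X).Finite ∧
      (((⋃ β ∈ elemSet (⊥ : IntermediateField ℚ Qbar) n (genBound n 1 X),
        fieldsOver (adjoinElem ⊥ β) n X) ∩ galFields n G X).ncard : ℝ) ≤
      C * X ^ (((n : ℝ) + 2) / 4 - 1 / (2 * (n : ℝ) - 2) + ε) := by
  classical
  obtain ⟨σ, hσ⟩ := Subgroup.exists_forall_conj_notMem hG
  have hn1 : (0 : ℝ) < n - 1 := by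
    have : (2 : ℝ) ≤ n := by exact_mod_cast hn
    linarith
  obtain ⟨C, hC0, hC⟩ := exists_bound_sievedCoeffs hn σ (ε := ε * (2 * (n - 1))) (by positivity)
  set e : ℝ := ((n : ℝ) + 2) * (n - 1) / 2 - 1 + ε * (2 * (n - 1)) with he
  let c : ℝ := 2 ^ n * (2 * (3 * n + 1) ^ n)
  refine ⟨C * c ^ e * n, by positivity, fun X hX => ?_⟩
  have hX0 : 0 < X := by linarith
  have hB := one_le_genBound (show 1 < n by omega) hX
  have hY : 1 ≤ 2 ^ n * genBound n 1 X :=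
    one_le_mul_of_one_le_of_one_le (one_le_pow₀ (by norm_num)) hB
  have hYX : (2 ^ n * genBound n 1 X) ^ e =
      c ^ e * X ^ (((n : ℝ) + 2) / 4 - 1 / (2 * (n : ℝ) - 2) + ε) := by
    have h1 : 2 ^ n * genBound n 1 X = c * X ^ (1 / (2 * ((n : ℝ) - 1))) := by
      simp only [genBound, c, Nat.cast_one]; ring
    rw [h1, Real.mul_rpow (by positivity) (by positivity), ← Real.rpow_mul hX0.le]
    congr 2
    rw [he, show 2 * (n : ℝ) - 2 = 2 * (n - 1) by ring]
    field_simp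
    ring
  obtain ⟨h1, h2⟩ := hC _ hY
  let R : (Fin (n - 1) → ℤ) → Finset (IntermediateField ℚ Qbar) := fun a =>
    ((polyOf n a).map (algebraMap ℤ Qbar)).roots.toFinset.image (adjoinElem ⊥)
  have hR : ∀ a, (R a).card ≤ n := fun a =>
    Finset.card_image_le.trans ((Multiset.toFinset_card_le _).trans ((card_roots' _).trans
      (natDegree_map_le.trans (natDegree_polyOf_le n a))))
  obtain ⟨h3, h4⟩ := ncard_biUnion_le_mul h1 h2 (b := n)
    (f := fun a => (R a : Set (IntermediateField ℚ Qbar))) (by positivity) fun a _ =>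
    ⟨(R a).finite_toSet, by
      rw [Set.ncard_coe_finset]; exact_mod_cast hR a⟩
  have hsub : (⋃ β ∈ elemSet (⊥ : IntermediateField ℚ Qbar) n (genBound n 1 X),
      fieldsOver (adjoinElem ⊥ β) n X) ∩ galFields n G X ⊆
      ⋃ a ∈ sievedCoeffs n σ (2 ^ n * genBound n 1 X), (R a : Set (IntermediateField ℚ Qbar)) := by
    rintro K ⟨hK, -, -, hKG⟩
    simp only [Set.mem_iUnion] at hK
    obtain ⟨β, hβ, hβK, hKn, -⟩ := hK
    have hfK : FiniteDimensional ℚ K := FiniteDimensional.of_finrank_pos (by omega)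
    obtain rfl : adjoinElem ⊥ β = K := by
      refine IntermediateField.eq_of_le_of_finrank_eq hβK ?_
      rw [finrank_adjoinElem, hβ.2.1, IntermediateField.finrank_bot, one_mul, hKn]
    obtain ⟨a, ha, hdeg, haY⟩ := exists_minpoly_eq_polyOf (by omega) hB hβ
    have hmon : (polyOf n a).Monic := ha ▸ minpoly.monic hβ.1
    have hroot : aeval β (polyOf n a) = 0 := ha ▸ minpoly.aeval ℤ β
    simp only [Set.mem_iUnion]
    refine ⟨a, ⟨haY, fun p hp => ?_⟩, ?_⟩
    · refine notMem_frobSet hKG (β := ⟨β, mem_adjoinElem ⊥ β⟩) adjoinElem_bot_algHom_ext ?_ hdeg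
        hmon hσ p
      apply (adjoinElem ⊥ β).val.injective
      have := aeval_algHom_apply ((adjoinElem ⊥ β).val.restrictScalars ℤ)
        ⟨β, mem_adjoinElem ⊥ β⟩ (polyOf n a)
      rw [map_zero]
      exact this.symm.trans hroot
    · refine Finset.mem_coe.2 (Finset.mem_image_of_mem _ ?_)
      rw [Multiset.mem_toFinset, mem_roots (hmon.map _).ne_zero, IsRoot, eval_map_algebraMap]
      exact hroot
  refine ⟨h3.subset hsub, ?_⟩
  calc _ ≤ _ := by exact_mod_cast Set.ncard_le_ncard hsub h3
    _ ≤ _ := h4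
    _ = _ := by rw [hYX]; ring

theorem exists_bound_fieldsOver_intermediate {n m : ℕ} (hm : 2 ≤ m) (hmn : m < n) (hdvd : m ∣ n) :
    ∃ C : ℝ, 0 ≤ C ∧ ∀ X : ℝ, 1 ≤ X →
      (⋃ β ∈ elemSet (⊥ : IntermediateField ℚ Qbar) m (genBound n 1 X),
        fieldsOver (adjoinElem ⊥ β) n X).Finite ∧
      ((⋃ β ∈ elemSet (⊥ : IntermediateField ℚ Qbar) m (genBound n 1 X),
        fieldsOver (adjoinElem ⊥ β) n X).ncard : ℝ) ≤
      C * X ^ (((n : ℝ) + 2) / 4 - 1 / (2 * (n : ℝ) - 2)) := by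
  obtain ⟨M, hM⟩ := hdvd
  have H := exists_bound_fieldsOver (n := n) (n - 1 * m) (1 * m) rfl (by omega) (by omega)
  obtain ⟨C, hC0, hC⟩ := exists_bound_elemSet_fields one_pos (by omega) hm H
  refine ⟨C, hC0, fun X hX => ?_⟩
  obtain ⟨h1, h2⟩ := hC ⟨⊥, X⟩ ⟨IntermediateField.finrank_bot, hX⟩
  refine ⟨h1, h2.trans (mul_le_mul_of_nonneg_left (Real.rpow_le_rpow_of_exponent_le hX ?_) hC0)⟩
  have hM2 : 2 ≤ M := by
    by_contra! h
    have : M ≤ 1 := by omega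
    nlinarith
  have hM' : (2 : ℝ) ≤ M := by exact_mod_cast hM2
  have hm' : (2 : ℝ) ≤ m := by exact_mod_cast hm
  have hn : (n : ℝ) = m * M := by exact_mod_cast hM
  have e1 : (n : ℝ) / (1 * m : ℕ) = M := by
    rw [hn]; push_cast; field_simp
  have hpos : (0 : ℝ) < m * M - 1 := by nlinarith
  rw [e1, hn, show 2 * ((m : ℝ) * M) - 2 = 2 * (m * M - 1) by ring, Nat.cast_one]
  have key : (m : ℝ) * (m + 1) ≤ M * (m - 1) * (m * M - 1) := by
    nlinarith [mul_nonneg (sub_nonneg.2 hm') (sub_nonneg.2 hM'),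
      mul_le_mul (show 2 * ((m : ℝ) - 1) ≤ M * (m - 1) by nlinarith)
        (show 2 * (m : ℝ) - 1 ≤ m * M - 1 by nlinarith) (by linarith) (by nlinarith),
      mul_nonneg (sub_nonneg.2 hm') (show (0 : ℝ) ≤ 3 * m - 1 by linarith)]
  rw [← sub_nonneg]
  have : ((m : ℝ) * M + 2) / 4 - 1 / (2 * (m * M - 1)) -
      (((m : ℝ) + 2) * (m - 1) * 1 / (4 * (m * M - 1)) + ((M : ℝ) + 2) / 4) =
      (M * (m - 1) * (m * M - 1) - m * (m + 1)) / (4 * (m * M - 1)) := by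
    field_simp
    ring
  rw [this]
  exact div_nonneg (sub_nonneg.2 key) (by linarith)

/-- (Corollary of Dummit's theorem.) For `n ≥ 2` and `G` a proper
transitive subgroup of `Sₙ`, `F_n(X;G) ≪_{n,ε} X^{δ_n+ε}` where
`δ_n = (n+2)/4 − 1/(2n−2)`. -/
theorem dummit_corollary (n : ℕ) (hn : 2 ≤ n)
    (G : Subgroup (Equiv.Perm (Fin n)))
    (htrans : IsTransitiveSub G) (hproper : G ≠ ⊤)
    (ε : ℝ) (hε : 0 < ε) :
    ∃ c : ℝ, 0 < c ∧ ∀ X : ℝ, 2 ≤ X →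
      (FnG n X G : ℝ) ≤
        c * X ^ (((n : ℝ) + 2) / 4 - 1 / (2 * (n : ℝ) - 2) + ε) := by
  obtain ⟨C, hC0, hC⟩ := exists_bound_biUnion ((Finset.Icc 2 n).filter fun m => 1 * m ∣ n)
    (fun m X => (⋃ β ∈ elemSet (⊥ : IntermediateField ℚ Qbar) m (genBound n 1 X),
      fieldsOver (adjoinElem ⊥ β) n X) ∩ galFields n G X)
    (fun X : ℝ => (max X 1) ^ (((n : ℝ) + 2) / 4 - 1 / (2 * (n : ℝ) - 2) + ε)) (fun X => 1 ≤ X) (by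
      intro m hm
      rw [Finset.mem_filter, Finset.mem_Icc, one_mul] at hm
      rcases hm.1.2.lt_or_eq with h | rfl
      · obtain ⟨C, hC0, hC⟩ := exists_bound_fieldsOver_intermediate hm.1.1 h hm.2
        refine ⟨C, hC0, fun X hX => ⟨(hC X hX).1.subset Set.inter_subset_left, ?_⟩⟩
        rw [max_eq_left hX]
        calc _ ≤ _ := by
              exact_mod_cast Set.ncard_le_ncard Set.inter_subset_left (hC X hX).1
          _ ≤ _ := (hC X hX).2
          _ ≤ _ := mul_le_mul_of_nonneg_left
            (Real.rpow_le_rpow_of_exponent_le hX (by linarith)) hC0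
      · obtain ⟨C, hC0, hC⟩ := exists_bound_galFields_generic hn hproper hε
        refine ⟨C, hC0, fun X hX => ?_⟩
        rw [max_eq_left hX]
        exact hC X hX)
  refine ⟨C + 1, by linarith, fun X hX => ?_⟩
  have hX1 : 1 ≤ X := by linarith
  obtain ⟨h1, h2⟩ := hC X hX1
  rw [max_eq_left hX1] at h2
  have hsub : galFields n G X ⊆ ⋃ m ∈ (Finset.Icc 2 n).filter fun m => 1 * m ∣ n,
      (⋃ β ∈ elemSet (⊥ : IntermediateField ℚ Qbar) m (genBound n 1 X),
        fieldsOver (adjoinElem ⊥ β) n X) ∩ galFields n G X := by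
    intro K hK
    have h := fieldsOver_subset (F := ⊥) IntermediateField.finrank_bot one_pos (by omega) hX1
      (show K ∈ fieldsOver ⊥ n X from ⟨bot_le, hK.1, hK.2.1⟩)
    rw [← Set.iUnion₂_inter]
    exact ⟨h, hK⟩
  have h3 : FnG n X G = (galFields n G X).ncard := Nat.card_coe_set_eq (galFields n G X)
  rw [h3]
  have hX0 : 0 < X := by linarith
  calc ((galFields n G X).ncard : ℝ) ≤ _ := by exact_mod_cast Set.ncard_le_ncard hsub h1
    _ ≤ _ := h2
    _ ≤ _ := mul_le_mul_of_nonneg_right (by linarith) (by positivity)
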